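/- If there exists an adequate B-removing mapping for a formula B, then there exists an adequate □B-removing mapping. -/

import Mathlib

inductive Formula : Type
  | atom : ℕ → Formula
  | bot  : Formula
  | imp  : Formula → Formula → Formula
  | box  : Formula → Formula
deriving DecidableEq

def boxtimes (Γ : Multiset Formula) : Multiset Formula := Γ + Γ.map Formula.box

inductive GoSeq : Bool → Multiset Formula → Multiset Formula → Prop
  | ax (c) (Γ Δ : Multiset Formula) (A : Formula) : GoSeq c (A ::ₘ Γ) (A ::ₘ Δ)
  | axBot (c) (Γ Δ : Multiset Formula) : GoSeq c (Formula.bot ::ₘ Γ) Δ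
  | impL (c) (Γ Δ : Multiset Formula) (A B : Formula) :
      GoSeq c (B ::ₘ Γ) Δ → GoSeq c Γ (A ::ₘ Δ) → GoSeq c ((A.imp B) ::ₘ Γ) Δ
  | impR (c) (Γ Δ : Multiset Formula) (A B : Formula) :
      GoSeq c (A ::ₘ Γ) (B ::ₘ Δ) → GoSeq c Γ ((A.imp B) ::ₘ Δ)
  | boxGo (c) (Γ Δ Θ : Multiset Formula) (A : Formula) :
      GoSeq c ((Formula.box (A.imp (Formula.box A))) ::ₘ boxtimes Θ) {A} →
      GoSeq c (Γ + Θ.map Formula.box) ((Formula.box A) ::ₘ Δ)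
  | cut (Γ Δ : Multiset Formula) (A : Formula) :
      GoSeq true Γ (A ::ₘ Δ) → GoSeq true (A ::ₘ Γ) Δ → GoSeq true Γ Δ

inductive Frag : Bool → ℕ → Multiset Formula → Multiset Formula → Type
  | hole (c) (Γ Δ : Multiset Formula) : Frag c 0 Γ Δ
  | axP (c) (n) (Γ Δ : Multiset Formula) (p : ℕ) :
      Frag c (n+1) (Formula.atom p ::ₘ Γ) (Formula.atom p ::ₘ Δ)
  | axBot (c) (n) (Γ Δ : Multiset Formula) : Frag c (n+1) (Formula.bot ::ₘ Γ) Δ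
  | impL (c) (n) (Γ Δ : Multiset Formula) (A B : Formula) :
      Frag c (n+1) (B ::ₘ Γ) Δ → Frag c (n+1) Γ (A ::ₘ Δ) →
      Frag c (n+1) ((A.imp B) ::ₘ Γ) Δ
  | impR (c) (n) (Γ Δ : Multiset Formula) (A B : Formula) :
      Frag c (n+1) (A ::ₘ Γ) (B ::ₘ Δ) → Frag c (n+1) Γ ((A.imp B) ::ₘ Δ)
  | box (c) (n) (Γ Δ Θ : Multiset Formula) (l : List Formula) (h : l ≠ []) :
      Frag c (n+1) (boxtimes Θ) (boxtimes (↑l)) →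
      ((i : Fin l.length) → Frag c n (boxtimes Θ) {l.get i}) →
      Frag c (n+1) (Γ + Θ.map Formula.box) ((↑(l.map Formula.box) : Multiset Formula) + Δ)
  | cut (n) (Γ Δ : Multiset Formula) (A : Formula) :
      Frag true (n+1) Γ (A ::ₘ Δ) → Frag true (n+1) (A ::ₘ Γ) Δ → Frag true (n+1) Γ Δ

def Frag.trunc : ∀ {c : Bool} {n : ℕ} {Γ Δ : Multiset Formula}, Frag c (n+1) Γ Δ → Frag c n Γ Δ
  | c, 0, Γ, Δ, _ => .hole c Γ Δ
  | c, n+1, _, _, .axP _ _ Γ Δ p => .axP c n Γ Δ p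
  | c, n+1, _, _, .axBot _ _ Γ Δ => .axBot c n Γ Δ
  | c, n+1, _, _, .impL _ _ Γ Δ A B a b => .impL c n Γ Δ A B a.trunc b.trunc
  | c, n+1, _, _, .impR _ _ Γ Δ A B a => .impR c n Γ Δ A B a.trunc
  | c, n+1, _, _, .box _ _ Γ Δ Θ l h a bs => .box c n Γ Δ Θ l h a.trunc (fun i => (bs i).trunc)
  | _, n+1, _, _, .cut _ Γ Δ A a b => .cut n Γ Δ A a.trunc b.trunc

def Frag.height : ∀ {c : Bool} {n : ℕ} {Γ Δ : Multiset Formula}, Frag c n Γ Δ → ℕ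
  | _, _, _, _, .hole _ _ _ => 0
  | _, _, _, _, .axP _ _ _ _ _ => 0
  | _, _, _, _, .axBot _ _ _ _ => 0
  | _, _, _, _, .impL _ _ _ _ _ _ a b => max a.height b.height + 1
  | _, _, _, _, .impR _ _ _ _ _ _ a => a.height + 1
  | _, _, _, _, .box _ _ _ _ _ _ _ a bs =>
      max a.height (Finset.univ.sup fun i => (bs i).height) + 1
  | _, _, _, _, .cut _ _ _ _ a b => max a.height b.height + 1

def Frag.cutFree : ∀ {c : Bool} {n : ℕ} {Γ Δ : Multiset Formula}, Frag c n Γ Δ → Prop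
  | _, _, _, _, .hole _ _ _ => True
  | _, _, _, _, .axP _ _ _ _ _ => True
  | _, _, _, _, .axBot _ _ _ _ => True
  | _, _, _, _, .impL _ _ _ _ _ _ a b => a.cutFree ∧ b.cutFree
  | _, _, _, _, .impR _ _ _ _ _ _ a => a.cutFree
  | _, _, _, _, .box _ _ _ _ _ _ _ a bs => a.cutFree ∧ ∀ i, (bs i).cutFree
  | _, _, _, _, .cut _ _ _ _ _ _ => False

structure InfProof (c : Bool) (Γ Δ : Multiset Formula) : Type where
  frag : ∀ n : ℕ, Frag c n Γ Δ
  compat : ∀ n : ℕ, (frag (n+1)).trunc = frag n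

structure PP : Type where
  Γ : Multiset Formula
  Δ : Multiset Formula
  prf : InfProof true Γ Δ

def Sim : ℕ → PP → PP → Prop
  | 0, _, _ => True
  | n+1, π, τ => π.Γ = τ.Γ ∧ π.Δ = τ.Δ ∧ HEq (π.prf.frag (n+1)) (τ.prf.frag (n+1))

noncomputable def dP (π τ : PP) : ℝ :=
  sInf {r : ℝ | ∃ n : ℕ, Sim n π τ ∧ r = (1/2 : ℝ) ^ n}

def localHeight (π : PP) : ℕ := (π.prf.frag 1).height

def Pmem (n : ℕ) (π : PP) : Prop := (π.prf.frag n).cutFree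

def IsUltrametric {M : Type*} (d : M → M → ℝ) : Prop :=
  (∀ x y, 0 ≤ d x y) ∧ (∀ x y, d x y = 0 ↔ x = y) ∧ (∀ x y, d x y = d y x) ∧
  (∀ x y z, d x z ≤ max (d x y) (d y z))

def cBall {M : Type*} (d : M → M → ℝ) (x : M) (r : ℝ) : Set M := {y | d x y ≤ r}

def SphericallyComplete {M : Type*} (d : M → M → ℝ) : Prop :=
  ∀ (c : ℕ → M) (r : ℕ → ℝ), (∀ n, 0 ≤ r n) →
    (∀ n, cBall d (c (n+1)) (r (n+1)) ⊆ cBall d (c n) (r n)) →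
    ∃ x, ∀ n, x ∈ cBall d (c n) (r n)

def NonExpansive1 (u : PP → PP) : Prop := ∀ π τ, dP (u π) (u τ) ≤ dP π τ

def Adequate1 (u : PP → PP) : Prop := ∀ n π, Pmem n π → Pmem n (u π)

noncomputable def dPm {m : ℕ} (x y : Fin m → PP) : ℝ := ⨆ i, dP (x i) (y i)

def NonExpansiveM {m : ℕ} (u : (Fin m → PP) → PP) : Prop :=
  ∀ x y, dP (u x) (u y) ≤ dPm x y

def Fm (m : ℕ) : Type := {u : (Fin m → PP) → PP // NonExpansiveM u}

def SimF {m : ℕ} (n k : ℕ) (a b : (Fin m → PP) → PP) : Prop :=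
  (∀ x, Sim n (a x) (b x)) ∧
  (∀ x, (∑ i, localHeight (x i)) < k → Sim (n+1) (a x) (b x))

noncomputable def lm {m : ℕ} (a b : (Fin m → PP) → PP) : ℝ :=
  (1/2) * sInf {r : ℝ | ∃ n k : ℕ, SimF n k a b ∧ r = (1/2 : ℝ) ^ n + (1/2 : ℝ) ^ (n + k)}

noncomputable def dP2 (p q : PP × PP) : ℝ := max (dP p.1 q.1) (dP p.2 q.2)

def NonExpansive2 (u : PP × PP → PP) : Prop := ∀ p q, dP (u p) (u q) ≤ dP2 p q

def Adequate2 (u : PP × PP → PP) : Prop :=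
  ∀ n π τ, Pmem n π → Pmem n τ → Pmem n (u (π, τ))

def Removing (A : Formula) (u : PP × PP → PP) : Prop :=
  ∀ (Γ Δ : Multiset Formula) (π τ : PP),
    π.Γ = Γ → π.Δ = A ::ₘ Δ → τ.Γ = A ::ₘ Γ → τ.Δ = Δ →
    (u (π, τ)).Γ = Γ ∧ (u (π, τ)).Δ = Δ

def RA (A : Formula) : Type := {u : PP × PP → PP // NonExpansive2 u ∧ Removing A u}

def SimF2 (n k : ℕ) (a b : PP × PP → PP) : Prop :=
  (∀ p, Sim n (a p) (b p)) ∧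
  (∀ p : PP × PP, localHeight p.1 + localHeight p.2 < k → Sim (n+1) (a p) (b p))

noncomputable def l2 (a b : PP × PP → PP) : ℝ :=
  (1/2) * sInf {r : ℝ | ∃ n k : ℕ, SimF2 n k a b ∧ r = (1/2 : ℝ) ^ n + (1/2 : ℝ) ^ (n + k)}

namespace GoCut

/-- One inference step: `X` supplies the premises in the same main fragment, `Y` the right premises
of the box rule. -/
inductive Node (c : Bool) (X Y : Multiset Formula → Multiset Formula → Type)
    (Γ Δ : Multiset Formula) : Type
  | axP (p : ℕ) (Γ' Δ' : Multiset Formula) (h : Γ = Formula.atom p ::ₘ Γ')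
      (h' : Δ = Formula.atom p ::ₘ Δ') : Node c X Y Γ Δ
  | axBot (Γ' : Multiset Formula) (h : Γ = Formula.bot ::ₘ Γ') : Node c X Y Γ Δ
  | impL (A B : Formula) (Γ' : Multiset Formula) (h : Γ = A.imp B ::ₘ Γ')
      (a : X (B ::ₘ Γ') Δ) (b : X Γ' (A ::ₘ Δ)) : Node c X Y Γ Δ
  | impR (A B : Formula) (Δ' : Multiset Formula) (h : Δ = A.imp B ::ₘ Δ')
      (a : X (A ::ₘ Γ) (B ::ₘ Δ')) : Node c X Y Γ Δ
  | box (Γ' Δ' Θ : Multiset Formula) (l : List Formula) (hl : l ≠ [])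
      (h : Γ = Γ' + Θ.map Formula.box)
      (h' : Δ = (↑(l.map Formula.box) : Multiset Formula) + Δ')
      (a : X (boxtimes Θ) (boxtimes ↑l))
      (bs : (i : Fin l.length) → Y (boxtimes Θ) {l.get i}) : Node c X Y Γ Δ
  | cut (A : Formula) (hc : c = true) (a : X Γ (A ::ₘ Δ)) (b : X (A ::ₘ Γ) Δ) : Node c X Y Γ Δ

namespace Node

variable {c : Bool} {X Y X' Y' : Multiset Formula → Multiset Formula → Type}
  {Γ Δ : Multiset Formula}

def map (f : ∀ {Γ Δ}, X Γ Δ → X' Γ Δ) (g : ∀ {Γ Δ}, Y Γ Δ → Y' Γ Δ) :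
    Node c X Y Γ Δ → Node c X' Y' Γ Δ
  | .axP p Γ' Δ' h h' => .axP p Γ' Δ' h h'
  | .axBot Γ' h => .axBot Γ' h
  | .impL A B Γ' h a b => .impL A B Γ' h (f a) (f b)
  | .impR A B Δ' h a => .impR A B Δ' h (f a)
  | .box Γ' Δ' Θ l hl h h' a bs => .box Γ' Δ' Θ l hl h h' (f a) (fun i => g (bs i))
  | .cut A hc a b => .cut A hc (f a) (f b)

end Node

instance (c : Bool) (Γ Δ : Multiset Formula) : Subsingleton (Frag c 0 Γ Δ) :=
  ⟨by rintro ⟨⟩ ⟨⟩; rfl⟩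

end GoCut

namespace Frag

open GoCut

variable {c : Bool} {n : ℕ} {Γ Δ : Multiset Formula}

def ofNode : Node c (Frag c (n + 1)) (Frag c n) Γ Δ → Frag c (n + 1) Γ Δ
  | .axP p Γ' Δ' h h' => by subst h h'; exact .axP c n Γ' Δ' p
  | .axBot Γ' h => by subst h; exact .axBot c n Γ' Δ
  | .impL A B Γ' h a b => by subst h; exact .impL c n Γ' Δ A B a b
  | .impR A B Δ' h a => by subst h; exact .impR c n Γ Δ' A B a
  | .box Γ' Δ' Θ l hl h h' a bs => by subst h h'; exact .box c n Γ' Δ' Θ l hl a bs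
  | .cut A hc a b => by subst hc; exact .cut n Γ Δ A a b

def toNode : Frag c (n + 1) Γ Δ → Node c (Frag c (n + 1)) (Frag c n) Γ Δ
  | .axP _ _ Γ' Δ' p => .axP p Γ' Δ' rfl rfl
  | .axBot _ _ Γ' _ => .axBot Γ' rfl
  | .impL _ _ Γ' _ A B a b => .impL A B Γ' rfl a b
  | .impR _ _ _ Δ' A B a => .impR A B Δ' rfl a
  | .box _ _ Γ' Δ' Θ l hl a bs => .box Γ' Δ' Θ l hl rfl rfl a bs
  | .cut _ _ _ A a b => .cut A rfl a b

@[simp] theorem toNode_ofNode (x : Node c (Frag c (n + 1)) (Frag c n) Γ Δ) :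
    (ofNode x).toNode = x := by
  cases x <;> subst_vars <;> rfl

theorem ofNode_toNode (f : Frag c (n + 1) Γ Δ) : ofNode f.toNode = f := by
  cases f <;> rfl

theorem ofNode_injective :
    Function.Injective (ofNode : Node c (Frag c (n + 1)) (Frag c n) Γ Δ → _) :=
  Function.LeftInverse.injective toNode_ofNode

@[simp] theorem trunc_ofNode (x : Node c (Frag c (n + 2)) (Frag c (n + 1)) Γ Δ) :
    (ofNode x).trunc = ofNode (x.map Frag.trunc Frag.trunc) := by
  cases x <;> subst_vars <;> simp only [ofNode, trunc, Node.map]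

theorem height_eq_zero (f : Frag c 0 Γ Δ) : f.height = 0 := by
  cases f; rfl

theorem cutFree_of_zero (f : Frag c 0 Γ Δ) : f.cutFree := by
  cases f; trivial

theorem cutFree_trunc : ∀ {c : Bool} {n : ℕ} {Γ Δ : Multiset Formula} (f : Frag c (n + 1) Γ Δ),
    f.cutFree → f.trunc.cutFree
  | c, 0, Γ, Δ, f, _ => cutFree_of_zero _
  | c, n + 1, _, _, .axP _ _ Γ Δ p, _ => by simp only [trunc, cutFree]
  | c, n + 1, _, _, .axBot _ _ Γ Δ, _ => by simp only [trunc, cutFree]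
  | c, n + 1, _, _, .impL _ _ Γ Δ A B a b, h => by
    simp only [trunc, cutFree] at h ⊢; exact ⟨cutFree_trunc a h.1, cutFree_trunc b h.2⟩
  | c, n + 1, _, _, .impR _ _ Γ Δ A B a, h => by
    simp only [trunc, cutFree] at h ⊢; exact cutFree_trunc a h
  | c, n + 1, _, _, .box _ _ Γ Δ Θ l hl a bs, h => by
    simp only [trunc, cutFree] at h ⊢
    exact ⟨cutFree_trunc a h.1, fun i => cutFree_trunc (bs i) (h.2 i)⟩
  | _, n + 1, _, _, .cut _ Γ Δ A a b, h => by simp only [cutFree] at h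

/-! ### Weakening and inversion -/

def wk : ∀ {c : Bool} {n : ℕ} {Γ Δ : Multiset Formula}, Frag c n Γ Δ →
    ∀ Γ' Δ' : Multiset Formula, Γ ≤ Γ' → Δ ≤ Δ' → Frag c n Γ' Δ'
  | _, _, _, _, .hole c _ _, Γ', Δ', _, _ => .hole c Γ' Δ'
  | _, _, _, _, .axP _ _ _ _ p, Γ', Δ', h, h' =>
    ofNode (.axP p (Γ'.erase (.atom p)) (Δ'.erase (.atom p))
      (Multiset.cons_erase (Multiset.mem_of_le h (by simp))).symm
      (Multiset.cons_erase (Multiset.mem_of_le h' (by simp))).symm)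
  | _, _, _, _, .axBot _ _ _ _, Γ', Δ', h, _ =>
    ofNode (.axBot (Γ'.erase .bot) (Multiset.cons_erase (Multiset.mem_of_le h (by simp))).symm)
  | _, _, _, _, .impL _ _ _ _ A B a b, Γ', Δ', h, h' =>
    ofNode (.impL A B (Γ'.erase (A.imp B))
      (Multiset.cons_erase (Multiset.mem_of_le h (by simp))).symm
      (a.wk _ _ (Multiset.cons_le_cons _ (by simpa using Multiset.erase_le_erase (A.imp B) h)) h')
      (b.wk _ _ (by simpa using Multiset.erase_le_erase (A.imp B) h)
        (Multiset.cons_le_cons _ h')))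
  | _, _, _, _, .impR _ _ _ _ A B a, Γ', Δ', h, h' =>
    ofNode (.impR A B (Δ'.erase (A.imp B))
      (Multiset.cons_erase (Multiset.mem_of_le h' (by simp))).symm
      (a.wk _ _ (Multiset.cons_le_cons _ h)
        (Multiset.cons_le_cons _ (by simpa using Multiset.erase_le_erase (A.imp B) h'))))
  | _, _, _, _, .box _ _ _ _ Θ l hl a bs, Γ', Δ', h, h' =>
    ofNode (.box (Γ' - Θ.map Formula.box) (Δ' - ↑(l.map Formula.box)) Θ l hl
      (tsub_add_cancel_of_le ((Multiset.le_add_left _ _).trans h)).symm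
      (add_tsub_cancel_of_le ((Multiset.le_add_right _ _).trans h')).symm a bs)
  | _, _, _, _, .cut _ _ _ A a b, Γ', Δ', h, h' =>
    ofNode (.cut A rfl (a.wk _ _ h (Multiset.cons_le_cons _ h'))
      (b.wk _ _ (Multiset.cons_le_cons _ h) h'))

def isCutFree (x : Node c (Frag c (n + 1)) (Frag c n) Γ Δ) : Prop :=
  match x with
  | .axP .. => True
  | .axBot .. => True
  | .impL _ _ _ _ a b => a.cutFree ∧ b.cutFree
  | .impR _ _ _ _ a => a.cutFree
  | .box _ _ _ _ _ _ _ a bs => a.cutFree ∧ ∀ i, (bs i).cutFree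
  | .cut .. => False

@[simp] theorem cutFree_ofNode (x : Node c (Frag c (n + 1)) (Frag c n) Γ Δ) :
    (ofNode x).cutFree ↔ isCutFree x := by
  cases x <;> subst_vars <;> simp only [ofNode, cutFree, isCutFree]

def nodeHeight (x : Node c (Frag c (n + 1)) (Frag c n) Γ Δ) : ℕ :=
  match x with
  | .axP .. => 0
  | .axBot .. => 0
  | .impL _ _ _ _ a b => max a.height b.height + 1
  | .impR _ _ _ _ a => a.height + 1
  | .box _ _ _ _ _ _ _ a bs => max a.height (Finset.univ.sup fun i => (bs i).height) + 1
  | .cut _ _ a b => max a.height b.height + 1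

@[simp] theorem height_ofNode (x : Node c (Frag c (n + 1)) (Frag c n) Γ Δ) :
    (ofNode x).height = nodeHeight x := by
  cases x <;> subst_vars <;> simp only [ofNode, height, nodeHeight]

theorem trunc_wk : ∀ {c : Bool} {n : ℕ} {Γ Δ : Multiset Formula} (f : Frag c (n + 1) Γ Δ)
    (Γ' Δ' : Multiset Formula) (h : Γ ≤ Γ') (h' : Δ ≤ Δ'),
    (f.wk Γ' Δ' h h').trunc = f.trunc.wk Γ' Δ' h h'
  | c, 0, Γ, Δ, f, _, _, _, _ => Subsingleton.elim _ _
  | c, n + 1, _, _, .axP _ _ Γ Δ p, _, _, _, _ => by simp [trunc, wk, Node.map]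
  | c, n + 1, _, _, .axBot _ _ Γ Δ, _, _, _, _ => by simp [trunc, wk, Node.map]
  | c, n + 1, _, _, .impL _ _ Γ Δ A B a b, _, _, _, _ => by
    simp [trunc, wk, Node.map, trunc_wk a, trunc_wk b]
  | c, n + 1, _, _, .impR _ _ Γ Δ A B a, _, _, _, _ => by
    simp [trunc, wk, Node.map, trunc_wk a]
  | c, n + 1, _, _, .box _ _ Γ Δ Θ l hl a bs, _, _, _, _ => by
    simp [trunc, wk, Node.map]
  | _, n + 1, _, _, .cut _ Γ Δ A a b, _, _, _, _ => by
    simp [trunc, wk, Node.map, trunc_wk a, trunc_wk b]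

theorem cutFree_wk (f : Frag c n Γ Δ) : ∀ (Γ' Δ' : Multiset Formula) (h : Γ ≤ Γ') (h' : Δ ≤ Δ'),
    f.cutFree → (f.wk Γ' Δ' h h').cutFree := by
  induction f with
  | hole => intros; trivial
  | axP => intros; simp [wk, isCutFree]
  | axBot => intros; simp [wk, isCutFree]
  | impL c n Γ Δ A B a b iha ihb =>
    intro _ _ _ _ hf
    simp only [wk, cutFree_ofNode, isCutFree]
    exact ⟨iha _ _ _ _ hf.1, ihb _ _ _ _ hf.2⟩
  | impR c n Γ Δ A B a iha =>
    intro _ _ _ _ hf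
    simp only [wk, cutFree_ofNode, isCutFree]
    exact iha _ _ _ _ hf
  | box c n Γ Δ Θ l hl a bs =>
    intro _ _ _ _ hf
    simp only [wk, cutFree_ofNode, isCutFree]
    exact hf
  | cut => intro _ _ _ _ hf; exact hf.elim

theorem height_wk (f : Frag c n Γ Δ) : ∀ (Γ' Δ' : Multiset Formula) (h : Γ ≤ Γ') (h' : Δ ≤ Δ'),
    (f.wk Γ' Δ' h h').height = f.height := by
  induction f with
  | hole => intros; rfl
  | axP => intros; simp [wk, nodeHeight, height]
  | axBot => intros; simp [wk, nodeHeight, height]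
  | impL c n Γ Δ A B a b iha ihb => intros; simp [wk, nodeHeight, height, iha, ihb]
  | impR c n Γ Δ A B a iha => intros; simp [wk, nodeHeight, height, iha]
  | box c n Γ Δ Θ l hl a bs => intros; simp [wk, nodeHeight, height]
  | cut n Γ Δ A a b iha ihb => intros; simp [wk, nodeHeight, height, iha, ihb]

end Frag

namespace GoCut

theorem le_of_add_cons_le_cons {P Γ Γ' : Multiset Formula} {X : Formula}
    (h : P + (X ::ₘ Γ) ≤ X ::ₘ Γ') : P + Γ ≤ Γ' := by
  rw [Multiset.add_cons] at h
  exact (Multiset.cons_le_cons_iff X).1 h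

theorem mem_of_add_cons_le {P Γ Γ' : Multiset Formula} {Z : Formula}
    (h : P + (Z ::ₘ Γ) ≤ Γ') : Z ∈ Γ' :=
  Multiset.mem_of_le h (by simp)

theorem mem_of_add_cons_le_cons {P Γ Γ' : Multiset Formula} {X Z : Formula}
    (h : P + (Z ::ₘ Γ) ≤ X ::ₘ Γ') (hZ : Z ≠ X) : Z ∈ Γ' :=
  (Multiset.mem_cons.1 (mem_of_add_cons_le h)).resolve_left hZ

theorem add_le_erase {P Γ Γ' : Multiset Formula} {Z : Formula}
    (h : P + (Z ::ₘ Γ) ≤ Γ') : P + Γ ≤ Γ'.erase Z := by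
  rw [Multiset.add_cons] at h
  simpa using Multiset.erase_le_erase Z h

theorem add_le_cons_erase {P Γ Γ' : Multiset Formula} {X Z : Formula}
    (h : P + (Z ::ₘ Γ) ≤ X ::ₘ Γ') (hZ : Z ≠ X) : P + Γ ≤ X ::ₘ Γ'.erase Z := by
  rw [← Multiset.erase_cons_tail _ hZ.symm]
  exact add_le_erase h

theorem add_cons_le_cons {P Γ Γ' : Multiset Formula} (W : Formula) (h : P + Γ ≤ Γ') :
    P + (W ::ₘ Γ) ≤ W ::ₘ Γ' := by
  rw [Multiset.add_cons]
  exact Multiset.cons_le_cons _ h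

theorem add_cons_le_cons_cons {P Γ Γ' : Multiset Formula} {X : Formula} (W : Formula)
    (h : P + Γ ≤ X ::ₘ Γ') : P + (W ::ₘ Γ) ≤ X ::ₘ W ::ₘ Γ' := by
  rw [Multiset.cons_swap]
  exact add_cons_le_cons W h

theorem imp_notMem_map_box (A B : Formula) (Θ : Multiset Formula) :
    A.imp B ∉ Θ.map Formula.box := by
  simp

theorem le_of_le_cons {Θ Γ : Multiset Formula} {X : Formula} (h : Θ ≤ X ::ₘ Γ) (hX : X ∉ Θ) :
    Θ ≤ Γ :=
  (Multiset.le_cons_of_notMem hX).1 h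

/-- The antecedent formulas that replace `A → B` in the chosen premise of the left implication
rule. -/
def invAnte (s : Bool) (B : Formula) : Multiset Formula := if s then {B} else 0

/-- The succedent formulas that replace `A → B` in the chosen premise of the left implication
rule. -/
def invSucc (s : Bool) (A : Formula) : Multiset Formula := if s then 0 else {A}

theorem left_premise_le {A B C D : Formula} {Γ Δ Γ' Δ' : Multiset Formula}
    (e : C.imp D = A.imp B) (h : invAnte true B + (C.imp D ::ₘ Γ) ≤ A.imp B ::ₘ Γ')
    (h' : invSucc true A + Δ ≤ Δ') : D ::ₘ Γ ≤ Γ' ∧ Δ ≤ Δ' := by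
  cases e
  exact ⟨by simpa [invAnte] using le_of_add_cons_le_cons h, by simpa [invSucc] using h'⟩

theorem right_premise_le {A B C D : Formula} {Γ Δ Γ' Δ' : Multiset Formula}
    (e : C.imp D = A.imp B) (h : invAnte false B + (C.imp D ::ₘ Γ) ≤ A.imp B ::ₘ Γ')
    (h' : invSucc false A + Δ ≤ Δ') : Γ ≤ Γ' ∧ C ::ₘ Δ ≤ Δ' := by
  cases e
  exact ⟨by simpa [invAnte] using le_of_add_cons_le_cons h, by simpa [invSucc] using h'⟩

theorem imp_right_premise_le {A B C D : Formula} {Γ Δ Γ' Δ' : Multiset Formula}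
    (e : C.imp D = A.imp B) (h : {A} + Γ ≤ Γ')
    (h' : {B} + (C.imp D ::ₘ Δ) ≤ A.imp B ::ₘ Δ') : C ::ₘ Γ ≤ Γ' ∧ D ::ₘ Δ ≤ Δ' := by
  cases e
  exact ⟨by simpa using h, by simpa using le_of_add_cons_le_cons h'⟩

end GoCut

namespace Frag

open GoCut

variable {c : Bool} {n : ℕ} {Γ Δ : Multiset Formula}

def invL (s : Bool) (A B : Formula) : ∀ {c : Bool} {n : ℕ} {Γ Δ : Multiset Formula},
    Frag c n Γ Δ → ∀ Γ' Δ' : Multiset Formula, invAnte s B + Γ ≤ A.imp B ::ₘ Γ' →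
      invSucc s A + Δ ≤ Δ' → Frag c n Γ' Δ'
  | _, _, _, _, .hole c _ _, Γ', Δ', _, _ => .hole c Γ' Δ'
  | _, _, _, _, .axP _ _ _ _ p, Γ', Δ', h, h' =>
    ofNode (.axP p (Γ'.erase (.atom p)) (Δ'.erase (.atom p))
      (Multiset.cons_erase (mem_of_add_cons_le_cons h (by simp))).symm
      (Multiset.cons_erase (mem_of_add_cons_le h')).symm)
  | _, _, _, _, .axBot _ _ _ _, Γ', Δ', h, _ =>
    ofNode (.axBot (Γ'.erase .bot)
      (Multiset.cons_erase (mem_of_add_cons_le_cons h (by simp))).symm)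
  | _, _, _, _, .impL _ _ _ _ C D a b, Γ', Δ', h, h' =>
    if e : C.imp D = A.imp B then
      match s, h, h' with
      | true, h, h' => a.wk _ _ (left_premise_le e h h').1 (left_premise_le e h h').2
      | false, h, h' => b.wk _ _ (right_premise_le e h h').1 (right_premise_le e h h').2
    else
      ofNode (.impL C D (Γ'.erase (C.imp D))
        (Multiset.cons_erase (mem_of_add_cons_le_cons h e)).symm
        (a.invL s A B _ _ (add_cons_le_cons_cons D (add_le_cons_erase h e)) h')
        (b.invL s A B _ _ (add_le_cons_erase h e) (add_cons_le_cons C h')))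
  | _, _, _, _, .impR _ _ _ _ C D a, Γ', Δ', h, h' =>
    ofNode (.impR C D (Δ'.erase (C.imp D)) (Multiset.cons_erase (mem_of_add_cons_le h')).symm
      (a.invL s A B _ _ (add_cons_le_cons_cons C h) (add_cons_le_cons D (add_le_erase h'))))
  | _, _, _, _, .box _ _ _ _ Θ l hl a bs, Γ', Δ', h, h' =>
    ofNode (.box (Γ' - Θ.map Formula.box) (Δ' - ↑(l.map Formula.box)) Θ l hl
      (tsub_add_cancel_of_le (le_of_le_cons
        (((Multiset.le_add_left _ _).trans (Multiset.le_add_left _ _)).trans h)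
        (imp_notMem_map_box A B Θ))).symm
      (add_tsub_cancel_of_le
        (((Multiset.le_add_right _ _).trans (Multiset.le_add_left _ _)).trans h')).symm a bs)
  | _, _, _, _, .cut _ _ _ C a b, Γ', Δ', h, h' =>
    ofNode (.cut C rfl (a.invL s A B _ _ h (add_cons_le_cons C h'))
      (b.invL s A B _ _ (add_cons_le_cons_cons C h) h'))

theorem trunc_invL (s : Bool) (A B : Formula) : ∀ {c : Bool} {n : ℕ} {Γ Δ : Multiset Formula}
    (f : Frag c (n + 1) Γ Δ) (Γ' Δ' : Multiset Formula)
    (h : invAnte s B + Γ ≤ A.imp B ::ₘ Γ') (h' : invSucc s A + Δ ≤ Δ'),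
    (f.invL s A B Γ' Δ' h h').trunc = f.trunc.invL s A B Γ' Δ' h h'
  | c, 0, Γ, Δ, f, _, _, _, _ => Subsingleton.elim _ _
  | c, n + 1, _, _, .axP _ _ Γ Δ p, _, _, _, _ => by simp [trunc, invL, Node.map]
  | c, n + 1, _, _, .axBot _ _ Γ Δ, _, _, _, _ => by simp [trunc, invL, Node.map]
  | c, n + 1, _, _, .impL _ _ Γ Δ C D a b, _, _, _, _ => by
    simp only [trunc, invL]
    split_ifs with e
    · cases s <;> simp only [trunc_wk]
    · simp [Node.map, trunc_invL s A B a, trunc_invL s A B b]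
  | c, n + 1, _, _, .impR _ _ Γ Δ C D a, _, _, _, _ => by
    simp [trunc, invL, Node.map, trunc_invL s A B a]
  | c, n + 1, _, _, .box _ _ Γ Δ Θ l hl a bs, _, _, _, _ => by
    simp [trunc, invL, Node.map]
  | _, n + 1, _, _, .cut _ Γ Δ C a b, _, _, _, _ => by
    simp [trunc, invL, Node.map, trunc_invL s A B a, trunc_invL s A B b]

theorem cutFree_invL (s : Bool) (A B : Formula) (f : Frag c n Γ Δ) :
    ∀ (Γ' Δ' : Multiset Formula) (h : invAnte s B + Γ ≤ A.imp B ::ₘ Γ')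
      (h' : invSucc s A + Δ ≤ Δ'), f.cutFree → (f.invL s A B Γ' Δ' h h').cutFree := by
  induction f with
  | hole => intros; trivial
  | axP => intros; simp [invL, isCutFree]
  | axBot => intros; simp [invL, isCutFree]
  | impL c n Γ Δ C D a b iha ihb =>
    intro _ _ _ _ hf
    simp only [invL]
    split_ifs with e
    · cases s
      · exact cutFree_wk _ _ _ _ _ hf.2
      · exact cutFree_wk _ _ _ _ _ hf.1
    · simp only [cutFree_ofNode, isCutFree]
      exact ⟨iha _ _ _ _ hf.1, ihb _ _ _ _ hf.2⟩
  | impR c n Γ Δ C D a iha =>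
    intro _ _ _ _ hf
    simp only [invL, cutFree_ofNode, isCutFree]
    exact iha _ _ _ _ hf
  | box c n Γ Δ Θ l hl a bs =>
    intro _ _ _ _ hf
    simp only [invL, cutFree_ofNode, isCutFree]
    exact hf
  | cut => intro _ _ _ _ hf; exact hf.elim

theorem height_invL_le (s : Bool) (A B : Formula) (f : Frag c n Γ Δ) :
    ∀ (Γ' Δ' : Multiset Formula) (h : invAnte s B + Γ ≤ A.imp B ::ₘ Γ')
      (h' : invSucc s A + Δ ≤ Δ'), (f.invL s A B Γ' Δ' h h').height ≤ f.height := by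
  induction f with
  | hole => intros; exact le_rfl
  | axP => intros; simp [invL, nodeHeight, height]
  | axBot => intros; simp [invL, nodeHeight, height]
  | impL c n Γ Δ C D a b iha ihb =>
    intros
    simp only [invL]
    split_ifs with e
    · cases s
      · simp only [height_wk, height]; omega
      · simp only [height_wk, height]; omega
    · simp only [height_ofNode, nodeHeight, height]
      exact Nat.succ_le_succ (max_le_max (iha _ _ _ _) (ihb _ _ _ _))
  | impR c n Γ Δ C D a iha =>
    intros
    simp only [invL, height_ofNode, nodeHeight, height]
    exact Nat.succ_le_succ (iha _ _ _ _)
  | box c n Γ Δ Θ l hl a bs => intros; simp [invL, nodeHeight, height]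
  | cut n Γ Δ C a b iha ihb =>
    intros
    simp only [invL, height_ofNode, nodeHeight, height]
    exact Nat.succ_le_succ (max_le_max (iha _ _ _ _) (ihb _ _ _ _))

def invR (A B : Formula) : ∀ {c : Bool} {n : ℕ} {Γ Δ : Multiset Formula},
    Frag c n Γ Δ → ∀ Γ' Δ' : Multiset Formula, {A} + Γ ≤ Γ' →
      {B} + Δ ≤ A.imp B ::ₘ Δ' → Frag c n Γ' Δ'
  | _, _, _, _, .hole c _ _, Γ', Δ', _, _ => .hole c Γ' Δ'
  | _, _, _, _, .axP _ _ _ _ p, Γ', Δ', h, h' =>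
    ofNode (.axP p (Γ'.erase (.atom p)) (Δ'.erase (.atom p))
      (Multiset.cons_erase (mem_of_add_cons_le h)).symm
      (Multiset.cons_erase (mem_of_add_cons_le_cons h' (by simp))).symm)
  | _, _, _, _, .axBot _ _ _ _, Γ', Δ', h, _ =>
    ofNode (.axBot (Γ'.erase .bot) (Multiset.cons_erase (mem_of_add_cons_le h)).symm)
  | _, _, _, _, .impL _ _ _ _ C D a b, Γ', Δ', h, h' =>
    ofNode (.impL C D (Γ'.erase (C.imp D)) (Multiset.cons_erase (mem_of_add_cons_le h)).symm
      (a.invR A B _ _ (add_cons_le_cons D (add_le_erase h)) h')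
      (b.invR A B _ _ (add_le_erase h) (add_cons_le_cons_cons C h')))
  | _, _, _, _, .impR _ _ _ _ C D a, Γ', Δ', h, h' =>
    if e : C.imp D = A.imp B then
      a.wk _ _ (imp_right_premise_le e h h').1 (imp_right_premise_le e h h').2
    else
      ofNode (.impR C D (Δ'.erase (C.imp D))
        (Multiset.cons_erase (mem_of_add_cons_le_cons h' e)).symm
        (a.invR A B _ _ (add_cons_le_cons C h)
          (add_cons_le_cons_cons D (add_le_cons_erase h' e))))
  | _, _, _, _, .box _ _ _ _ Θ l hl a bs, Γ', Δ', h, h' =>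
    ofNode (.box (Γ' - Θ.map Formula.box) (Δ' - ↑(l.map Formula.box)) Θ l hl
      (tsub_add_cancel_of_le
        (((Multiset.le_add_left _ _).trans (Multiset.le_add_left _ _)).trans h)).symm
      (add_tsub_cancel_of_le (le_of_le_cons
        (((Multiset.le_add_right _ _).trans (Multiset.le_add_left _ _)).trans h')
        (imp_notMem_map_box A B ↑l))).symm a bs)
  | _, _, _, _, .cut _ _ _ C a b, Γ', Δ', h, h' =>
    ofNode (.cut C rfl (a.invR A B _ _ h (add_cons_le_cons_cons C h'))
      (b.invR A B _ _ (add_cons_le_cons C h) h'))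

theorem trunc_invR (A B : Formula) : ∀ {c : Bool} {n : ℕ} {Γ Δ : Multiset Formula}
    (f : Frag c (n + 1) Γ Δ) (Γ' Δ' : Multiset Formula)
    (h : {A} + Γ ≤ Γ') (h' : {B} + Δ ≤ A.imp B ::ₘ Δ'),
    (f.invR A B Γ' Δ' h h').trunc = f.trunc.invR A B Γ' Δ' h h'
  | c, 0, Γ, Δ, f, _, _, _, _ => Subsingleton.elim _ _
  | c, n + 1, _, _, .axP _ _ Γ Δ p, _, _, _, _ => by simp [trunc, invR, Node.map]
  | c, n + 1, _, _, .axBot _ _ Γ Δ, _, _, _, _ => by simp [trunc, invR, Node.map]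
  | c, n + 1, _, _, .impL _ _ Γ Δ C D a b, _, _, _, _ => by
    simp [trunc, invR, Node.map, trunc_invR A B a, trunc_invR A B b]
  | c, n + 1, _, _, .impR _ _ Γ Δ C D a, _, _, _, _ => by
    simp only [trunc, invR]
    split_ifs with e
    · simp only [trunc_wk]
    · simp [Node.map, trunc_invR A B a]
  | c, n + 1, _, _, .box _ _ Γ Δ Θ l hl a bs, _, _, _, _ => by
    simp [trunc, invR, Node.map]
  | _, n + 1, _, _, .cut _ Γ Δ C a b, _, _, _, _ => by
    simp [trunc, invR, Node.map, trunc_invR A B a, trunc_invR A B b]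

theorem cutFree_invR (A B : Formula) (f : Frag c n Γ Δ) :
    ∀ (Γ' Δ' : Multiset Formula) (h : {A} + Γ ≤ Γ') (h' : {B} + Δ ≤ A.imp B ::ₘ Δ'),
      f.cutFree → (f.invR A B Γ' Δ' h h').cutFree := by
  induction f with
  | hole => intros; trivial
  | axP => intros; simp [invR, isCutFree]
  | axBot => intros; simp [invR, isCutFree]
  | impL c n Γ Δ C D a b iha ihb =>
    intro _ _ _ _ hf
    simp only [invR, cutFree_ofNode, isCutFree]
    exact ⟨iha _ _ _ _ hf.1, ihb _ _ _ _ hf.2⟩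
  | impR c n Γ Δ C D a iha =>
    intro _ _ _ _ hf
    simp only [invR]
    split_ifs with e
    · exact cutFree_wk _ _ _ _ _ hf
    · simp only [cutFree_ofNode, isCutFree]
      exact iha _ _ _ _ hf
  | box c n Γ Δ Θ l hl a bs =>
    intro _ _ _ _ hf
    simp only [invR, cutFree_ofNode, isCutFree]
    exact hf
  | cut => intro _ _ _ _ hf; exact hf.elim

theorem height_invR_le (A B : Formula) (f : Frag c n Γ Δ) :
    ∀ (Γ' Δ' : Multiset Formula) (h : {A} + Γ ≤ Γ') (h' : {B} + Δ ≤ A.imp B ::ₘ Δ'),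
      (f.invR A B Γ' Δ' h h').height ≤ f.height := by
  induction f with
  | hole => intros; exact le_rfl
  | axP => intros; simp [invR, nodeHeight, height]
  | axBot => intros; simp [invR, nodeHeight, height]
  | impL c n Γ Δ C D a b iha ihb =>
    intros
    simp only [invR, height_ofNode, nodeHeight, height]
    exact Nat.succ_le_succ (max_le_max (iha _ _ _ _) (ihb _ _ _ _))
  | impR c n Γ Δ C D a iha =>
    intros
    simp only [invR]
    split_ifs with e
    · simp only [height_wk, height]; omega
    · simp only [height_ofNode, nodeHeight, height]
      exact Nat.succ_le_succ (iha _ _ _ _)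
  | box c n Γ Δ Θ l hl a bs => intros; simp [invR, nodeHeight, height]
  | cut n Γ Δ C a b iha ihb =>
    intros
    simp only [invR, height_ofNode, nodeHeight, height]
    exact Nat.succ_le_succ (max_le_max (iha _ _ _ _) (ihb _ _ _ _))

end Frag

namespace GoCut.Node

variable {c : Bool} {X Y X' Y' : Multiset Formula → Multiset Formula → Type}
  {Γ Δ : Multiset Formula} {f : ∀ {Γ Δ}, X Γ Δ → X' Γ Δ} {g : ∀ {Γ Δ}, Y Γ Δ → Y' Γ Δ}
  {x : Node c X Y Γ Δ}

theorem map_eq_axP {p Γ' Δ' h h'} (e : x.map f g = .axP p Γ' Δ' h h') :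
    x = .axP p Γ' Δ' h h' := by
  cases x <;> simp_all [map]

theorem map_eq_axBot {Γ' h} (e : x.map f g = .axBot Γ' h) : x = .axBot Γ' h := by
  cases x <;> simp_all [map]

theorem map_eq_impL {A B Γ' h a b} (e : x.map f g = .impL A B Γ' h a b) :
    ∃ a' b', x = .impL A B Γ' h a' b' ∧ f a' = a ∧ f b' = b := by
  cases x <;> simp only [map, impL.injEq, reduceCtorEq] at e
  obtain ⟨rfl, rfl, rfl, ha, hb⟩ := e
  exact ⟨_, _, rfl, eq_of_heq ha, eq_of_heq hb⟩

theorem map_eq_impR {A B Δ' h a} (e : x.map f g = .impR A B Δ' h a) :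
    ∃ a', x = .impR A B Δ' h a' ∧ f a' = a := by
  cases x <;> simp only [map, impR.injEq, reduceCtorEq] at e
  obtain ⟨rfl, rfl, rfl, ha⟩ := e
  exact ⟨_, rfl, eq_of_heq ha⟩

theorem map_eq_box {Γ' Δ' Θ l hl h h' a bs} (e : x.map f g = .box Γ' Δ' Θ l hl h h' a bs) :
    ∃ a' bs', x = .box Γ' Δ' Θ l hl h h' a' bs' ∧ f a' = a ∧ ∀ i, g (bs' i) = bs i := by
  cases x <;> simp only [map, box.injEq, reduceCtorEq] at e
  obtain ⟨rfl, rfl, rfl, rfl, ha, hb⟩ := e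
  exact ⟨_, _, rfl, eq_of_heq ha, fun i => congrFun (eq_of_heq hb) i⟩

theorem map_eq_cut {A hc a b} (e : x.map f g = .cut A hc a b) :
    ∃ a' b', x = .cut A hc a' b' ∧ f a' = a ∧ f b' = b := by
  cases x <;> simp only [map, cut.injEq, reduceCtorEq] at e
  obtain ⟨rfl, ha, hb⟩ := e
  exact ⟨_, _, rfl, eq_of_heq ha, eq_of_heq hb⟩

theorem map_map {X'' Y'' : Multiset Formula → Multiset Formula → Type}
    {f' : ∀ {Γ Δ}, X' Γ Δ → X'' Γ Δ} {g' : ∀ {Γ Δ}, Y' Γ Δ → Y'' Γ Δ} :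
    (x.map f g).map f' g' = x.map (fun a => f' (f a)) (fun b => g' (g b)) := by
  cases x <;> rfl

end GoCut.Node

namespace InfProof

open GoCut

variable {c : Bool} {Γ Δ : Multiset Formula}

theorem ext_frag {π τ : InfProof c Γ Δ} (h : ∀ n, π.frag n = τ.frag n) : π = τ := by
  cases π; cases τ
  simp only [mk.injEq]
  exact funext h

theorem ext_succ {π τ : InfProof c Γ Δ} (h : ∀ n, π.frag (n + 1) = τ.frag (n + 1)) : π = τ :=
  ext_frag fun
    | 0 => Subsingleton.elim _ _
    | n + 1 => h n

/-- The ∞-proof with a given last inference and given immediate subproofs. -/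
def ofNode (x : Node c (InfProof c) (InfProof c) Γ Δ) : InfProof c Γ Δ where
  frag
    | 0 => .hole c Γ Δ
    | n + 1 => Frag.ofNode (x.map (fun a => a.frag (n + 1)) (fun b => b.frag n))
  compat
    | 0 => Subsingleton.elim _ _
    | n + 1 => by simp only [Frag.trunc_ofNode, Node.map_map, compat]

theorem frag_ofNode (x : Node c (InfProof c) (InfProof c) Γ Δ) (n : ℕ) :
    (ofNode x).frag (n + 1) =
      Frag.ofNode (x.map (fun a => a.frag (n + 1)) (fun b => b.frag n)) :=
  rfl

theorem exists_node_of_compat (s : ∀ n, Node c (Frag c (n + 1)) (Frag c n) Γ Δ)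
    (hs : ∀ n, (s (n + 1)).map Frag.trunc Frag.trunc = s n) :
    ∃ x : Node c (InfProof c) (InfProof c) Γ Δ,
      ∀ n, x.map (fun a => a.frag (n + 1)) (fun b => b.frag n) = s n := by
  have lim : ∀ {Γ Δ : Multiset Formula} (a : ∀ n, Frag c (n + 1) Γ Δ),
      (∀ n, (a (n + 1)).trunc = a n) → ∃ π : InfProof c Γ Δ, ∀ n, π.frag (n + 1) = a n :=
    fun {Γ Δ} a ha =>
      ⟨⟨fun | 0 => .hole c Γ Δ | n + 1 => a n,
        fun | 0 => Subsingleton.elim _ _ | n + 1 => ha n⟩, fun _ => rfl⟩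
  cases h0 : s 0 with
  | axP p Γ' Δ' h h' =>
    refine ⟨.axP p Γ' Δ' h h', fun n => ?_⟩
    induction n with
    | zero => exact h0.symm
    | succ n ih => exact (Node.map_eq_axP ((hs n).trans ih.symm)).symm
  | axBot Γ' h =>
    refine ⟨.axBot Γ' h, fun n => ?_⟩
    induction n with
    | zero => exact h0.symm
    | succ n ih => exact (Node.map_eq_axBot ((hs n).trans ih.symm)).symm
  | impL A B Γ' h a b =>
    have key : ∀ n, ∃ a b, s n = .impL A B Γ' h a b := by
      intro n
      induction n with
      | zero => exact ⟨a, b, h0⟩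
      | succ n ih =>
        obtain ⟨a, b, e⟩ := ih
        obtain ⟨a', b', e', -⟩ := Node.map_eq_impL ((hs n).trans e)
        exact ⟨a', b', e'⟩
    choose a b e using key
    have hab : ∀ n, (a (n + 1)).trunc = a n ∧ (b (n + 1)).trunc = b n := fun n => by
      simpa [e, Node.map] using hs n
    obtain ⟨a', ha⟩ := lim a fun n => (hab n).1
    obtain ⟨b', hb⟩ := lim b fun n => (hab n).2
    exact ⟨.impL A B Γ' h a' b', fun n => by simp only [Node.map, ha, hb, e]⟩
  | impR A B Δ' h a =>
    have key : ∀ n, ∃ a, s n = .impR A B Δ' h a := by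
      intro n
      induction n with
      | zero => exact ⟨a, h0⟩
      | succ n ih =>
        obtain ⟨a, e⟩ := ih
        obtain ⟨a', e', -⟩ := Node.map_eq_impR ((hs n).trans e)
        exact ⟨a', e'⟩
    choose a e using key
    obtain ⟨a', ha⟩ := lim a fun n => by simpa [e, Node.map] using hs n
    exact ⟨.impR A B Δ' h a', fun n => by simp only [Node.map, ha, e]⟩
  | box Γ' Δ' Θ l hl h h' a bs =>
    have key : ∀ n, ∃ a bs, s n = .box Γ' Δ' Θ l hl h h' a bs := by
      intro n
      induction n with
      | zero => exact ⟨a, bs, h0⟩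
      | succ n ih =>
        obtain ⟨a, bs, e⟩ := ih
        obtain ⟨a', bs', e', -⟩ := Node.map_eq_box ((hs n).trans e)
        exact ⟨a', bs', e'⟩
    choose a bs e using key
    have hab : ∀ n, (a (n + 1)).trunc = a n ∧ (fun i => (bs (n + 1) i).trunc) = bs n :=
      fun n => by simpa [e, Node.map] using hs n
    obtain ⟨a', ha⟩ := lim a fun n => (hab n).1
    refine ⟨.box Γ' Δ' Θ l hl h h' a' fun i =>
      ⟨fun n => bs n i, fun n => congrFun (hab n).2 i⟩, fun n => ?_⟩
    simp only [Node.map, ha, e]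
  | cut A hc a b =>
    have key : ∀ n, ∃ a b, s n = .cut A hc a b := by
      intro n
      induction n with
      | zero => exact ⟨a, b, h0⟩
      | succ n ih =>
        obtain ⟨a, b, e⟩ := ih
        obtain ⟨a', b', e', -⟩ := Node.map_eq_cut ((hs n).trans e)
        exact ⟨a', b', e'⟩
    choose a b e using key
    have hab : ∀ n, (a (n + 1)).trunc = a n ∧ (b (n + 1)).trunc = b n := fun n => by
      simpa [e, Node.map] using hs n
    obtain ⟨a', ha⟩ := lim a fun n => (hab n).1
    obtain ⟨b', hb⟩ := lim b fun n => (hab n).2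
    exact ⟨.cut A hc a' b', fun n => by simp only [Node.map, ha, hb, e]⟩

theorem exists_ofNode_eq (π : InfProof c Γ Δ) : ∃ x, ofNode x = π := by
  obtain ⟨x, hx⟩ := exists_node_of_compat (fun n => (π.frag (n + 1)).toNode) fun n => by
    apply Frag.ofNode_injective
    rw [← Frag.trunc_ofNode, Frag.ofNode_toNode, Frag.ofNode_toNode, π.compat]
  exact ⟨x, ext_succ fun n => by rw [frag_ofNode, hx, Frag.ofNode_toNode]⟩

/-- The last inference of an ∞-proof. -/
noncomputable def node (π : InfProof c Γ Δ) : Node c (InfProof c) (InfProof c) Γ Δ :=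
  π.exists_ofNode_eq.choose

@[simp] theorem ofNode_node (π : InfProof c Γ Δ) : ofNode π.node = π :=
  π.exists_ofNode_eq.choose_spec

def wk (π : InfProof c Γ Δ) (Γ' Δ' : Multiset Formula) (h : Γ ≤ Γ') (h' : Δ ≤ Δ') :
    InfProof c Γ' Δ' where
  frag n := (π.frag n).wk Γ' Δ' h h'
  compat n := by rw [Frag.trunc_wk, π.compat]

def invL (s : Bool) (A B : Formula) (π : InfProof c Γ Δ) (Γ' Δ' : Multiset Formula)
    (h : invAnte s B + Γ ≤ A.imp B ::ₘ Γ') (h' : invSucc s A + Δ ≤ Δ') :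
    InfProof c Γ' Δ' where
  frag n := (π.frag n).invL s A B Γ' Δ' h h'
  compat n := by rw [Frag.trunc_invL, π.compat]

def invR (A B : Formula) (π : InfProof c Γ Δ) (Γ' Δ' : Multiset Formula)
    (h : {A} + Γ ≤ Γ') (h' : {B} + Δ ≤ A.imp B ::ₘ Δ') : InfProof c Γ' Δ' where
  frag n := (π.frag n).invR A B Γ' Δ' h h'
  compat n := by rw [Frag.trunc_invR, π.compat]

def ht (π : InfProof c Γ Δ) : ℕ := (π.frag 1).height

theorem ht_wk (π : InfProof c Γ Δ) {Γ' Δ' : Multiset Formula} (h : Γ ≤ Γ') (h' : Δ ≤ Δ') :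
    (π.wk Γ' Δ' h h').ht = π.ht :=
  Frag.height_wk _ _ _ _ _

theorem ht_invL_le {s : Bool} {A B : Formula} (π : InfProof c Γ Δ) {Γ' Δ' : Multiset Formula}
    (h : invAnte s B + Γ ≤ A.imp B ::ₘ Γ') (h' : invSucc s A + Δ ≤ Δ') :
    (π.invL s A B Γ' Δ' h h').ht ≤ π.ht :=
  Frag.height_invL_le _ _ _ _ _ _ _ _

theorem ht_invR_le {A B : Formula} (π : InfProof c Γ Δ) {Γ' Δ' : Multiset Formula}
    (h : {A} + Γ ≤ Γ') (h' : {B} + Δ ≤ A.imp B ::ₘ Δ') : (π.invR A B Γ' Δ' h h').ht ≤ π.ht :=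
  Frag.height_invR_le _ _ _ _ _ _ _

theorem ht_ofNode_impL {A B : Formula} {Γ' : Multiset Formula} (h : Γ = A.imp B ::ₘ Γ')
    (a : InfProof c (B ::ₘ Γ') Δ) (b : InfProof c Γ' (A ::ₘ Δ)) :
    (ofNode (.impL A B Γ' h a b)).ht = max a.ht b.ht + 1 := by
  simp [ht, frag_ofNode, Node.map, Frag.nodeHeight]

theorem ht_ofNode_impR {A B : Formula} {Δ' : Multiset Formula} (h : Δ = A.imp B ::ₘ Δ')
    (a : InfProof c (A ::ₘ Γ) (B ::ₘ Δ')) :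
    (ofNode (.impR A B Δ' h a)).ht = a.ht + 1 := by
  simp [ht, frag_ofNode, Node.map, Frag.nodeHeight]

theorem ht_ofNode_box {Γ' Δ' Θ : Multiset Formula} {l : List Formula} (hl : l ≠ [])
    (h : Γ = Γ' + Θ.map Formula.box) (h' : Δ = (↑(l.map Formula.box) : Multiset Formula) + Δ')
    (a : InfProof c (boxtimes Θ) (boxtimes ↑l))
    (bs : (i : Fin l.length) → InfProof c (boxtimes Θ) {l.get i}) :
    (ofNode (.box Γ' Δ' Θ l hl h h' a bs)).ht = a.ht + 1 := by
  simp [ht, frag_ofNode, Node.map, Frag.nodeHeight, Frag.height_eq_zero]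

/-- The `n`-fragments coincide and, if `p` holds, contain no cut. -/
def Rel (n : ℕ) (p : Prop) (π τ : InfProof c Γ Δ) : Prop :=
  π.frag n = τ.frag n ∧ (p → (π.frag n).cutFree)

section Rel

variable {n : ℕ} {p : Prop} {π τ : InfProof c Γ Δ}

theorem rel_zero (p : Prop) (π τ : InfProof c Γ Δ) : Rel 0 p π τ :=
  ⟨Subsingleton.elim _ _, fun _ => Frag.cutFree_of_zero _⟩

theorem Rel.of_succ (h : Rel (n + 1) p π τ) : Rel n p π τ := by
  rw [Rel, ← π.compat, ← τ.compat]
  exact ⟨congrArg _ h.1, fun hp => Frag.cutFree_trunc _ (h.2 hp)⟩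

theorem frag_eq_of_le {m : ℕ} (hm : m ≤ n) (h : π.frag n = τ.frag n) : π.frag m = τ.frag m := by
  induction n, hm using Nat.le_induction with
  | base => exact h
  | succ n _ ih => exact ih (by rw [← π.compat, h, τ.compat])

theorem Rel.ht_eq (h : Rel (n + 1) p π τ) : π.ht = τ.ht :=
  congrArg Frag.height (frag_eq_of_le (Nat.le_add_left 1 n) h.1)

theorem Rel.wk (h : Rel n p π τ) {Γ' Δ' : Multiset Formula} (hΓ : Γ ≤ Γ') (hΔ : Δ ≤ Δ') :
    Rel n p (π.wk Γ' Δ' hΓ hΔ) (τ.wk Γ' Δ' hΓ hΔ) :=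
  ⟨by simp only [InfProof.wk, h.1], fun hp => Frag.cutFree_wk _ _ _ _ _ (h.2 hp)⟩

theorem Rel.invL (h : Rel n p π τ) {s : Bool} {A B : Formula} {Γ' Δ' : Multiset Formula}
    (hΓ : invAnte s B + Γ ≤ A.imp B ::ₘ Γ') (hΔ : invSucc s A + Δ ≤ Δ') :
    Rel n p (π.invL s A B Γ' Δ' hΓ hΔ) (τ.invL s A B Γ' Δ' hΓ hΔ) :=
  ⟨by simp only [InfProof.invL, h.1], fun hp => Frag.cutFree_invL _ _ _ _ _ _ _ _ (h.2 hp)⟩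

theorem Rel.invR (h : Rel n p π τ) {A B : Formula} {Γ' Δ' : Multiset Formula}
    (hΓ : {A} + Γ ≤ Γ') (hΔ : {B} + Δ ≤ A.imp B ::ₘ Δ') :
    Rel n p (π.invR A B Γ' Δ' hΓ hΔ) (τ.invR A B Γ' Δ' hΓ hΔ) :=
  ⟨by simp only [InfProof.invR, h.1], fun hp => Frag.cutFree_invR _ _ _ _ _ _ _ (h.2 hp)⟩

/-- Equality of last inferences, with immediate subproofs compared by `Rel`. -/
inductive NodeRel (n : ℕ) (p : Prop) : Node c (InfProof c) (InfProof c) Γ Δ →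
    Node c (InfProof c) (InfProof c) Γ Δ → Prop
  | axP (q Γ' Δ' h h') : NodeRel n p (.axP q Γ' Δ' h h') (.axP q Γ' Δ' h h')
  | axBot (Γ' h) : NodeRel n p (.axBot Γ' h) (.axBot Γ' h)
  | impL (A B Γ' h a b a' b') (ha : Rel (n + 1) p a a') (hb : Rel (n + 1) p b b') :
      NodeRel n p (.impL A B Γ' h a b) (.impL A B Γ' h a' b')
  | impR (A B Δ' h a a') (ha : Rel (n + 1) p a a') :
      NodeRel n p (.impR A B Δ' h a) (.impR A B Δ' h a')
  | box (Γ' Δ' Θ l hl h h' a bs a' bs') (ha : Rel (n + 1) p a a')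
      (hbs : ∀ i, Rel n p (bs i) (bs' i)) :
      NodeRel n p (.box Γ' Δ' Θ l hl h h' a bs) (.box Γ' Δ' Θ l hl h h' a' bs')
  | cut (A hc a b a' b') (hp : ¬ p) (ha : Rel (n + 1) p a a') (hb : Rel (n + 1) p b b') :
      NodeRel n p (.cut A hc a b) (.cut A hc a' b')

theorem NodeRel.ofNode {x y : Node c (InfProof c) (InfProof c) Γ Δ} (h : NodeRel n p x y) :
    Rel (n + 1) p (ofNode x) (ofNode y) := by
  rw [Rel, frag_ofNode, frag_ofNode, Frag.cutFree_ofNode]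
  cases h with
  | axP => exact ⟨rfl, fun _ => trivial⟩
  | axBot => exact ⟨rfl, fun _ => trivial⟩
  | impL A B Γ' h a b a' b' ha hb =>
    exact ⟨by simp only [Node.map, ha.1, hb.1], fun hp => ⟨ha.2 hp, hb.2 hp⟩⟩
  | impR A B Δ' h a a' ha =>
    exact ⟨by simp only [Node.map, ha.1], fun hp => ha.2 hp⟩
  | box Γ' Δ' Θ l hl h h' a bs a' bs' ha hbs =>
    exact ⟨by simp only [Node.map, ha.1, fun i => (hbs i).1],
      fun hp => ⟨ha.2 hp, fun i => (hbs i).2 hp⟩⟩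
  | cut A hc a b a' b' hp ha hb =>
    exact ⟨by simp only [Node.map, ha.1, hb.1], fun h => (hp h).elim⟩

theorem Rel.nodeRel {x y : Node c (InfProof c) (InfProof c) Γ Δ}
    (h : Rel (n + 1) p (InfProof.ofNode x) (InfProof.ofNode y)) : NodeRel n p x y := by
  rw [Rel, frag_ofNode, frag_ofNode, Frag.cutFree_ofNode] at h
  obtain ⟨h, hp⟩ := h
  replace h := (Frag.ofNode_injective h).symm
  cases x with
  | axP => rw [Node.map_eq_axP h]; constructor
  | axBot => rw [Node.map_eq_axBot h]; constructor
  | impL =>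
    obtain ⟨a, b, rfl, ha, hb⟩ := Node.map_eq_impL h
    exact .impL _ _ _ _ _ _ _ _ ⟨ha.symm, fun q => (hp q).1⟩ ⟨hb.symm, fun q => (hp q).2⟩
  | impR =>
    obtain ⟨a, rfl, ha⟩ := Node.map_eq_impR h
    exact .impR _ _ _ _ _ _ ⟨ha.symm, fun q => hp q⟩
  | box =>
    obtain ⟨a, b, rfl, ha, hb⟩ := Node.map_eq_box h
    exact .box _ _ _ _ _ _ _ _ _ _ _ ⟨ha.symm, fun q => (hp q).1⟩
      fun i => ⟨(hb i).symm, fun q => (hp q).2 i⟩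
  | cut =>
    obtain ⟨a, b, rfl, ha, hb⟩ := Node.map_eq_cut h
    exact .cut _ _ _ _ _ _ (fun q => hp q) ⟨ha.symm, fun q => (hp q).elim⟩
      ⟨hb.symm, fun q => (hp q).elim⟩

theorem Rel.node (h : Rel (n + 1) p π τ) : NodeRel n p π.node τ.node :=
  Rel.nodeRel (by rwa [ofNode_node, ofNode_node])

end Rel

end InfProof

namespace GoCut

open InfProof

/-! ### Multisets of formulas -/

theorem boxtimes_mono {Γ Δ : Multiset Formula} (h : Γ ≤ Δ) : boxtimes Γ ≤ boxtimes Δ :=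
  add_le_add h (Multiset.map_le_map h)

theorem boxtimes_cons (A : Formula) (Γ : Multiset Formula) :
    boxtimes (A ::ₘ Γ) = A.box ::ₘ A ::ₘ boxtimes Γ := by
  rw [boxtimes, Multiset.map_cons, Multiset.cons_add, Multiset.add_cons, Multiset.cons_swap]
  rfl

theorem map_box_le_boxtimes (Γ : Multiset Formula) : Γ.map Formula.box ≤ boxtimes Γ :=
  Multiset.le_add_left _ _

theorem map_box_le_cons_boxtimes {Γ Δ : Multiset Formula} {A : Formula} (h : Γ ≤ A ::ₘ Δ) :
    Γ.map Formula.box ≤ A.box ::ₘ boxtimes Δ := by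
  refine (Multiset.map_le_map h).trans ?_
  rw [Multiset.map_cons]
  exact Multiset.cons_le_cons _ (map_box_le_boxtimes Δ)

theorem map_box_le_iff {Θ Γ : Multiset Formula} :
    Θ.map Formula.box ≤ Γ ↔ ∀ A, Θ.count A ≤ Γ.count A.box := by
  have inj : Function.Injective Formula.box := fun _ _ h => Formula.box.inj h
  rw [Multiset.le_iff_count]
  constructor
  · intro h A
    rw [← Multiset.count_map_eq_count' _ _ inj]
    exact h _
  · intro h A
    by_cases hA : A ∈ Θ.map Formula.box
    · obtain ⟨C, -, rfl⟩ := Multiset.mem_map.1 hA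
      rw [Multiset.count_map_eq_count' _ _ inj]
      exact h C
    · rw [Multiset.count_eq_zero_of_notMem hA]
      exact Nat.zero_le _

theorem map_box_union_le {Θ Λ Γ : Multiset Formula} (h : Θ.map Formula.box ≤ Γ)
    (h' : Λ.map Formula.box ≤ Γ) : (Θ ∪ Λ).map Formula.box ≤ Γ := by
  rw [map_box_le_iff] at *
  intro A
  rw [Multiset.count_union]
  exact max_le (h A) (h' A)

theorem map_box_erase_le {Θ Γ : Multiset Formula} {B : Formula} (hB : B ∈ Θ)
    (h : Θ.map Formula.box ≤ B.box ::ₘ Γ) : (Θ.erase B).map Formula.box ≤ Γ := by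
  rw [← Multiset.cons_erase hB, Multiset.map_cons] at h
  exact (Multiset.cons_le_cons_iff _).1 h

theorem mem_of_not_map_box_le {Θ Γ : Multiset Formula} {B : Formula}
    (h : Θ.map Formula.box ≤ B.box ::ₘ Γ) (h' : ¬ Θ.map Formula.box ≤ Γ) : B ∈ Θ := by
  by_contra hB
  exact h' (le_of_le_cons h (by simpa using hB))

theorem mem_of_cons_eq_cons {Γ Γ' : Multiset Formula} {X Y : Formula}
    (h : Y ::ₘ Γ = X ::ₘ Γ') (hX : X ≠ Y) : X ∈ Γ :=
  (Multiset.mem_cons.1 (h ▸ Multiset.mem_cons_self X Γ' : X ∈ Y ::ₘ Γ)).resolve_left hX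

theorem eq_cons_erase_of_cons_eq_cons {Γ Γ' : Multiset Formula} {X Y : Formula}
    (h : Y ::ₘ Γ = X ::ₘ Γ') (hX : X ≠ Y) : Γ' = Y ::ₘ Γ.erase X := by
  rw [← Multiset.erase_cons_tail _ hX.symm, h, Multiset.erase_cons_head]

theorem eq_cons_erase {Γ Γ' : Multiset Formula} {X Y : Formula}
    (h : Y ::ₘ Γ = X ::ₘ Γ') (hX : X ≠ Y) : Γ = X ::ₘ Γ.erase X :=
  (Multiset.cons_erase (mem_of_cons_eq_cons h hX)).symm

/-! ### Derived constructions on ∞-proofs -/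

def CutOp (A : Formula) : Type :=
  ∀ Γ Δ : Multiset Formula, InfProof true Γ (A ::ₘ Δ) → InfProof true (A ::ₘ Γ) Δ →
    InfProof true Γ Δ

/-- `w` and `w'` send related cut pairs of total local height below `k` to related ∞-proofs. -/
def RelBelow {A : Formula} (n : ℕ) (p : Prop) (k : ℕ) (w w' : CutOp A) : Prop :=
  ∀ (Γ Δ : Multiset Formula) (π π' : InfProof true Γ (A ::ₘ Δ))
    (τ τ' : InfProof true (A ::ₘ Γ) Δ), Rel n p π π' → Rel n p τ τ' → π.ht + τ.ht < k →
    Rel n p (w Γ Δ π τ) (w' Γ Δ π' τ')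

def RelOp {A : Formula} (n : ℕ) (p : Prop) (w w' : CutOp A) : Prop :=
  ∀ (Γ Δ : Multiset Formula) (π π' : InfProof true Γ (A ::ₘ Δ))
    (τ τ' : InfProof true (A ::ₘ Γ) Δ), Rel n p π π' → Rel n p τ τ' →
    Rel n p (w Γ Δ π τ) (w' Γ Δ π' τ')

def boxTo (Γ Δ Θ : Multiset Formula) (l : List Formula) (hl : l ≠ [])
    (h : Θ.map Formula.box ≤ Γ) (h' : (↑l : Multiset Formula).map Formula.box ≤ Δ)
    (a : InfProof true (boxtimes Θ) (boxtimes ↑l))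
    (bs : (i : Fin l.length) → InfProof true (boxtimes Θ) {l.get i}) : InfProof true Γ Δ :=
  InfProof.ofNode (.box (Γ - Θ.map Formula.box) (Δ - (↑l : Multiset Formula).map Formula.box) Θ l
    hl (tsub_add_cancel_of_le h).symm (add_tsub_cancel_of_le h').symm a bs)

section

variable {n : ℕ} {p : Prop} {Γ Δ Θ : Multiset Formula} {l : List Formula}

theorem ht_boxTo (hl : l ≠ []) (h : Θ.map Formula.box ≤ Γ)
    (h' : (↑l : Multiset Formula).map Formula.box ≤ Δ)
    (a : InfProof true (boxtimes Θ) (boxtimes ↑l))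
    (bs : (i : Fin l.length) → InfProof true (boxtimes Θ) {l.get i}) :
    (boxTo Γ Δ Θ l hl h h' a bs).ht = a.ht + 1 :=
  ht_ofNode_box ..

theorem rel_boxTo (hl : l ≠ []) (h : Θ.map Formula.box ≤ Γ)
    (h' : (↑l : Multiset Formula).map Formula.box ≤ Δ)
    {a a' : InfProof true (boxtimes Θ) (boxtimes ↑l)}
    {bs bs' : (i : Fin l.length) → InfProof true (boxtimes Θ) {l.get i}}
    (ha : Rel (n + 1) p a a') (hbs : ∀ i, Rel n p (bs i) (bs' i)) :
    Rel (n + 1) p (boxTo Γ Δ Θ l hl h h' a bs) (boxTo Γ Δ Θ l hl h h' a' bs') :=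
  (NodeRel.box _ _ _ _ _ _ _ _ _ _ _ ha hbs).ofNode

/-- The right premise of a box inference belonging to the formula `C`. -/
noncomputable def rightPremise (bs : (i : Fin l.length) → InfProof true (boxtimes Θ) {l.get i})
    (C : Formula) (hC : C ∈ l) : InfProof true (boxtimes Θ) {C} :=
  (bs (List.get_of_mem hC).choose).wk _ _ le_rfl (by rw [(List.get_of_mem hC).choose_spec])

theorem rel_rightPremise {bs bs' : (i : Fin l.length) → InfProof true (boxtimes Θ) {l.get i}}
    (hbs : ∀ i, Rel n p (bs i) (bs' i)) (C : Formula) (hC : C ∈ l) :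
    Rel n p (rightPremise bs C hC) (rightPremise bs' C hC) :=
  (hbs _).wk _ _

/-- Necessitation: from `⊠Θ ⇒ B` to `Γ ⇒ □B, Δ`. -/
def nec {B : Formula} (Γ Δ : Multiset Formula) (h : Θ.map Formula.box ≤ Γ)
    (a : InfProof true (boxtimes Θ) {B}) : InfProof true Γ (B.box ::ₘ Δ) :=
  boxTo Γ (B.box ::ₘ Δ) Θ [B] (by simp) h (by simp)
    (a.wk _ _ le_rfl (by simp [boxtimes]))
    (fun i => a.wk _ _ le_rfl (by simp))

theorem rel_nec {B : Formula} (h : Θ.map Formula.box ≤ Γ)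
    {a a' : InfProof true (boxtimes Θ) {B}} (ha : Rel n p a a') :
    Rel n p (nec Γ Δ h a) (nec Γ Δ h a') := by
  cases n with
  | zero => exact rel_zero _ _ _
  | succ n => exact rel_boxTo _ _ _ (ha.wk _ _) fun _ => ha.of_succ.wk _ _

end

/-! ### The principal case -/

section Principal

variable {B : Formula} {Θ Θ₁ Λ : Multiset Formula} {l m q : List Formula}

def principalLeft (U : CutOp B) (w : CutOp B.box) (hl : l ≠ []) (hm : m ≠ [])
    (hΘ : Θ ≤ Λ) (hΘ₁ : Θ₁ ≤ B ::ₘ Λ) (hlq : (↑l : Multiset Formula) ≤ B ::ₘ ↑q)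
    (hmq : (↑m : Multiset Formula) ≤ ↑q)
    (a : InfProof true (boxtimes Θ) (boxtimes ↑l))
    (bs : (i : Fin l.length) → InfProof true (boxtimes Θ) {l.get i})
    (a₁ : InfProof true (boxtimes Θ₁) (boxtimes ↑m))
    (bs₁ : (i : Fin m.length) → InfProof true (boxtimes Θ₁) {m.get i}) :
    InfProof true (boxtimes Λ) (boxtimes ↑q) :=
  U _ _
    (w (boxtimes Λ) (B ::ₘ boxtimes ↑q)
      (a.wk _ _ (boxtimes_mono hΘ) ((boxtimes_mono hlq).trans_eq (boxtimes_cons _ _)))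
      (boxTo _ _ Θ₁ m hm (map_box_le_cons_boxtimes hΘ₁)
        (((map_box_le_boxtimes _).trans (boxtimes_mono hmq)).trans (Multiset.le_cons_self _ _))
        a₁ bs₁))
    (w (B ::ₘ boxtimes Λ) (boxtimes ↑q)
      (boxTo _ _ Θ l hl
        (((map_box_le_boxtimes _).trans (boxtimes_mono hΘ)).trans (Multiset.le_cons_self _ _))
        (map_box_le_cons_boxtimes hlq) a bs)
      (a₁.wk _ _ ((boxtimes_mono hΘ₁).trans_eq (boxtimes_cons _ _)) (boxtimes_mono hmq)))

theorem rel_principalLeft {n : ℕ} {p : Prop} {k : ℕ} {U : CutOp B} {w w' : CutOp B.box}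
    (hU : RelOp (n + 1) p U U) (hw : RelBelow (n + 1) p k w w') (hl : l ≠ []) (hm : m ≠ [])
    (hΘ : Θ ≤ Λ) (hΘ₁ : Θ₁ ≤ B ::ₘ Λ) (hlq : (↑l : Multiset Formula) ≤ B ::ₘ ↑q)
    (hmq : (↑m : Multiset Formula) ≤ ↑q)
    {a a' : InfProof true (boxtimes Θ) (boxtimes ↑l)}
    {bs bs' : (i : Fin l.length) → InfProof true (boxtimes Θ) {l.get i}}
    {a₁ a₁' : InfProof true (boxtimes Θ₁) (boxtimes ↑m)}
    {bs₁ bs₁' : (i : Fin m.length) → InfProof true (boxtimes Θ₁) {m.get i}}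
    (ha : Rel (n + 1) p a a') (hbs : ∀ i, Rel n p (bs i) (bs' i))
    (ha₁ : Rel (n + 1) p a₁ a₁') (hbs₁ : ∀ i, Rel n p (bs₁ i) (bs₁' i))
    (hk : a.ht + a₁.ht + 1 < k) :
    Rel (n + 1) p (principalLeft U w hl hm hΘ hΘ₁ hlq hmq a bs a₁ bs₁)
      (principalLeft U w' hl hm hΘ hΘ₁ hlq hmq a' bs' a₁' bs₁') := by
  refine hU _ _ _ _ _ _ (hw _ _ _ _ _ _ (ha.wk _ _) (rel_boxTo _ _ _ ha₁ hbs₁) ?_)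
    (hw _ _ _ _ _ _ (rel_boxTo _ _ _ ha hbs) (ha₁.wk _ _) ?_)
  · rw [ht_wk, ht_boxTo]; omega
  · rw [ht_wk, ht_boxTo]; omega

open Classical in
noncomputable def principalRight (U : CutOp B) (w : CutOp B.box) (hB : B ∈ l)
    (hΘ : Θ ≤ Λ) (hΘ₁ : Θ₁ ≤ B ::ₘ Λ)
    (bs : (i : Fin l.length) → InfProof true (boxtimes Θ) {l.get i})
    (bs₁ : (i : Fin m.length) → InfProof true (boxtimes Θ₁) {m.get i})
    (C : Formula) (hC : C ∈ l ∨ C ∈ m) : InfProof true (boxtimes Λ) {C} :=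
  if h : C ∈ m then
    U _ _ ((rightPremise bs B hB).wk _ _ (boxtimes_mono hΘ) (by simp))
      (w (B ::ₘ boxtimes Λ) {C}
        (nec _ _ (((map_box_le_boxtimes _).trans (boxtimes_mono hΘ)).trans
          (Multiset.le_cons_self _ _)) (rightPremise bs B hB))
        ((rightPremise bs₁ C h).wk _ _ ((boxtimes_mono hΘ₁).trans_eq (boxtimes_cons _ _)) le_rfl))
  else (rightPremise bs C (hC.resolve_right h)).wk _ _ (boxtimes_mono hΘ) le_rfl

theorem rel_principalRight {n : ℕ} {p : Prop} {U : CutOp B} {w w' : CutOp B.box}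
    (hU : RelOp n p U U) (hw : RelOp n p w w') (hB : B ∈ l) (hΘ : Θ ≤ Λ) (hΘ₁ : Θ₁ ≤ B ::ₘ Λ)
    {bs bs' : (i : Fin l.length) → InfProof true (boxtimes Θ) {l.get i}}
    {bs₁ bs₁' : (i : Fin m.length) → InfProof true (boxtimes Θ₁) {m.get i}}
    (hbs : ∀ i, Rel n p (bs i) (bs' i)) (hbs₁ : ∀ i, Rel n p (bs₁ i) (bs₁' i))
    (C : Formula) (hC : C ∈ l ∨ C ∈ m) :
    Rel n p (principalRight U w hB hΘ hΘ₁ bs bs₁ C hC)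
      (principalRight U w' hB hΘ hΘ₁ bs' bs₁' C hC) := by
  unfold principalRight
  split_ifs with h
  · exact hU _ _ _ _ _ _ ((rel_rightPremise hbs _ _).wk _ _)
      (hw _ _ _ _ _ _ (rel_nec _ (rel_rightPremise hbs _ _)) ((rel_rightPremise hbs₁ _ _).wk _ _))
  · exact (rel_rightPremise hbs _ _).wk _ _

noncomputable def principal (U : CutOp B) (w₁ w₂ : CutOp B.box) (Γ Δ : Multiset Formula)
    (hm : m ≠ []) (hB : B ∈ l) (hB₁ : B ∈ Θ₁)
    (hΘ : Θ.map Formula.box ≤ Γ) (hl : (↑l : Multiset Formula).map Formula.box ≤ B.box ::ₘ Δ)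
    (hΘ₁ : Θ₁.map Formula.box ≤ B.box ::ₘ Γ) (hmΔ : (↑m : Multiset Formula).map Formula.box ≤ Δ)
    (a : InfProof true (boxtimes Θ) (boxtimes ↑l))
    (bs : (i : Fin l.length) → InfProof true (boxtimes Θ) {l.get i})
    (a₁ : InfProof true (boxtimes Θ₁) (boxtimes ↑m))
    (bs₁ : (i : Fin m.length) → InfProof true (boxtimes Θ₁) {m.get i}) : InfProof true Γ Δ :=
  boxTo Γ Δ (Θ ∪ Θ₁.erase B) ((↑l : Multiset Formula).erase B ∪ ↑m).toList
    (by
      obtain ⟨C, hC⟩ := List.exists_mem_of_ne_nil m hm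
      refine List.ne_nil_of_mem (a := C) ?_
      simp [hC])
    (map_box_union_le hΘ (map_box_erase_le hB₁ hΘ₁))
    (by
      rw [Multiset.coe_toList]
      exact map_box_union_le (map_box_erase_le hB hl) hmΔ)
    (principalLeft U w₂ (List.ne_nil_of_mem hB) hm Multiset.le_union_left
      (Multiset.erase_le_iff_le_cons.1 Multiset.le_union_right)
      (by
        rw [Multiset.coe_toList]
        exact Multiset.erase_le_iff_le_cons.1 Multiset.le_union_left)
      (by
        rw [Multiset.coe_toList]
        exact Multiset.le_union_right) a bs a₁ bs₁)
    fun i => principalRight U w₁ hB Multiset.le_union_left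
      (Multiset.erase_le_iff_le_cons.1 Multiset.le_union_right) bs bs₁ _
      ((Multiset.mem_union.1 (Multiset.mem_toList.1 (List.get_mem _ i))).imp
        Multiset.mem_of_mem_erase id)

theorem rel_principal {n : ℕ} {p : Prop} {k : ℕ} {U : CutOp B} {w₁ w₁' w₂ w₂' : CutOp B.box}
    (hU : ∀ n, RelOp n p U U) (hw₁ : RelOp n p w₁ w₁') (hw₂ : RelBelow (n + 1) p k w₂ w₂')
    {Γ Δ : Multiset Formula} (hm : m ≠ []) (hB : B ∈ l) (hB₁ : B ∈ Θ₁)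
    (hΘ : Θ.map Formula.box ≤ Γ) (hl : (↑l : Multiset Formula).map Formula.box ≤ B.box ::ₘ Δ)
    (hΘ₁ : Θ₁.map Formula.box ≤ B.box ::ₘ Γ) (hmΔ : (↑m : Multiset Formula).map Formula.box ≤ Δ)
    {a a' : InfProof true (boxtimes Θ) (boxtimes ↑l)}
    {bs bs' : (i : Fin l.length) → InfProof true (boxtimes Θ) {l.get i}}
    {a₁ a₁' : InfProof true (boxtimes Θ₁) (boxtimes ↑m)}
    {bs₁ bs₁' : (i : Fin m.length) → InfProof true (boxtimes Θ₁) {m.get i}}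
    (ha : Rel (n + 1) p a a') (hbs : ∀ i, Rel n p (bs i) (bs' i))
    (ha₁ : Rel (n + 1) p a₁ a₁') (hbs₁ : ∀ i, Rel n p (bs₁ i) (bs₁' i))
    (hk : a.ht + a₁.ht + 1 < k) :
    Rel (n + 1) p (principal U w₁ w₂ Γ Δ hm hB hB₁ hΘ hl hΘ₁ hmΔ a bs a₁ bs₁)
      (principal U w₁' w₂' Γ Δ hm hB hB₁ hΘ hl hΘ₁ hmΔ a' bs' a₁' bs₁') :=
  rel_boxTo _ _ _ (rel_principalLeft (hU _) hw₂ _ _ _ _ _ _ ha hbs ha₁ hbs₁ hk)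
    fun _ => rel_principalRight (hU _) hw₁ _ _ _ hbs hbs₁ _ _

end Principal

end GoCut

namespace GoCut

open InfProof

/-! ### One step of cut removal -/

theorem invAnte_le {s : Bool} {B X Z : Formula} {Γ Γ' : Multiset Formula} (h : Γ = X ::ₘ Γ') :
    invAnte s B + (Z ::ₘ Γ) ≤ X ::ₘ Z ::ₘ (invAnte s B + Γ') := by
  subst h
  simp only [← Multiset.singleton_add]
  exact le_of_eq (by abel)

theorem singleton_add_le {B X Z : Formula} {Γ Γ' : Multiset Formula} (h : Γ = X ::ₘ Γ') :
    {B} + (Z ::ₘ Γ) ≤ X ::ₘ Z ::ₘ B ::ₘ Γ' :=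
  invAnte_le (s := true) h

section

variable {A : Formula} {Γ Δ : Multiset Formula}

def plainCut (A : Formula) : CutOp A := fun _ _ π τ => ofNode (.cut A rfl π τ)

open Classical in
noncomputable def stepNode {B : Formula} (U : CutOp B) (w₁ w₂ : CutOp B.box)
    (x : Node true (InfProof true) (InfProof true) Γ (B.box ::ₘ Δ))
    (y : Node true (InfProof true) (InfProof true) (B.box ::ₘ Γ) Δ) : InfProof true Γ Δ :=
  match x with
  | .axP r Γ' _ h h' =>
    ofNode (.axP r Γ' (Δ.erase (.atom r)) h (eq_cons_erase h' (by simp)))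
  | .axBot Γ' h => ofNode (.axBot Γ' h)
  | .impL C D Γ' h a b =>
    ofNode (.impL C D Γ' h
      (w₂ _ _ a ((ofNode y).invL true C D _ _
        ((invAnte_le h).trans_eq (by simp [invAnte])) (by simp [invSucc])))
      (w₂ _ _ (b.wk _ _ le_rfl (Multiset.cons_swap _ _ _).le)
        ((ofNode y).invL false C D _ _
          ((invAnte_le h).trans_eq (by simp [invAnte])) (by simp [invSucc]))))
  | .impR C D _ h a =>
    ofNode (.impR C D (Δ.erase (C.imp D)) (eq_cons_erase h (by simp))
      (w₂ _ _
        (a.wk _ _ le_rfl (by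
          rw [eq_cons_erase_of_cons_eq_cons h (by simp), Multiset.cons_swap]))
        ((ofNode y).invR C D _ _ (by simp [Multiset.cons_swap])
          (by
            rw [Multiset.singleton_add, Multiset.cons_swap, ← eq_cons_erase h (by simp)]))))
  | .cut .. => plainCut _ _ _ (ofNode x) (ofNode y)
  | .box _ _ Θ l hl h h' a bs =>
    if hd : (↑l : Multiset Formula).map Formula.box ≤ Δ then
      boxTo Γ Δ Θ l hl (le_of_le_of_eq (Multiset.le_add_left _ _) h.symm) hd a bs
    else
      match y with
      | .axP r _ Δ' h₁ h₁' =>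
        ofNode (.axP r (Γ.erase (.atom r)) Δ' (eq_cons_erase h₁ (by simp)) h₁')
      | .axBot _ h₁ => ofNode (.axBot (Γ.erase .bot) (eq_cons_erase h₁ (by simp)))
      | .impL C D _ h₁ a₁ b₁ =>
        ofNode (.impL C D (Γ.erase (C.imp D)) (eq_cons_erase h₁ (by simp))
          (w₂ _ _
            ((ofNode x).invL true C D _ _
              (by
                rw [invAnte, if_pos rfl, Multiset.singleton_add, Multiset.cons_swap,
                  ← eq_cons_erase h₁ (by simp)])
              (by simp [invSucc]))
            (a₁.wk _ _ (by
              rw [eq_cons_erase_of_cons_eq_cons h₁ (by simp), Multiset.cons_swap]) le_rfl))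
          (w₂ _ _
            ((ofNode x).invL false C D _ _
              (by
                rw [invAnte, if_neg (by simp), zero_add, ← eq_cons_erase h₁ (by simp)])
              (by simp [invSucc, Multiset.cons_swap]))
            (b₁.wk _ _ (eq_cons_erase_of_cons_eq_cons h₁ (by simp)).le le_rfl)))
      | .impR C D Δ' h₁ a₁ =>
        ofNode (.impR C D Δ' h₁
          (w₂ _ _ ((ofNode x).invR C D _ _ (by simp) (singleton_add_le h₁))
            (a₁.wk _ _ (Multiset.cons_swap _ _ _).le le_rfl)))
      | .cut .. => plainCut _ _ _ (ofNode x) (ofNode y)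
      | .box _ _ Θ₁ m hm h₁ h₁' a₁ bs₁ =>
        if hd₁ : Θ₁.map Formula.box ≤ Γ then
          boxTo Γ Δ Θ₁ m hm hd₁ (le_of_le_of_eq (Multiset.le_add_right _ _) h₁'.symm) a₁ bs₁
        else
          principal U w₁ w₂ Γ Δ hm
            (mem_of_not_map_box_le (le_of_le_of_eq (Multiset.le_add_right _ _) h'.symm) hd)
            (mem_of_not_map_box_le (le_of_le_of_eq (Multiset.le_add_left _ _) h₁.symm) hd₁)
            (le_of_le_of_eq (Multiset.le_add_left _ _) h.symm)
            (le_of_le_of_eq (Multiset.le_add_right _ _) h'.symm)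
            (le_of_le_of_eq (Multiset.le_add_left _ _) h₁.symm)
            (le_of_le_of_eq (Multiset.le_add_right _ _) h₁'.symm) a bs a₁ bs₁

theorem rel_plainCut {n : ℕ} {p : Prop} (hp : ¬ p) {π π' : InfProof true Γ (A ::ₘ Δ)}
    {τ τ' : InfProof true (A ::ₘ Γ) Δ} (hπ : Rel n p π π') (hτ : Rel n p τ τ') :
    Rel n p (plainCut A Γ Δ π τ) (plainCut A Γ Δ π' τ') := by
  cases n with
  | zero => exact rel_zero _ _ _
  | succ n => exact (NodeRel.cut _ _ _ _ _ _ hp hπ hτ).ofNode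

theorem rel_stepNode {n : ℕ} {p : Prop} {k : ℕ} {B : Formula} {U : CutOp B}
    {w₁ w₁' w₂ w₂' : CutOp B.box} (hU : ∀ n, RelOp n p U U) (hw₁ : RelOp n p w₁ w₁')
    (hw₂ : RelBelow (n + 1) p k w₂ w₂')
    {x x' : Node true (InfProof true) (InfProof true) Γ (B.box ::ₘ Δ)}
    {y y' : Node true (InfProof true) (InfProof true) (B.box ::ₘ Γ) Δ}
    (hx : NodeRel n p x x') (hy : NodeRel n p y y')
    (hk : (ofNode x).ht + (ofNode y).ht < k + 1) :
    Rel (n + 1) p (stepNode U w₁ w₂ x y) (stepNode U w₁' w₂' x' y') := by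
  have hX := hx.ofNode
  have hY := hy.ofNode
  cases hx with
  | axP => exact (NodeRel.axP _ _ _ _ _).ofNode
  | axBot => exact (NodeRel.axBot _ _).ofNode
  | impL C D Γ' h a b a' b' ha hb =>
    rw [ht_ofNode_impL] at hk
    refine (NodeRel.impL _ _ _ _ _ _ _ _ (hw₂ _ _ _ _ _ _ ha (hY.invL _ _) ?_)
      (hw₂ _ _ _ _ _ _ (hb.wk _ _) (hY.invL _ _) ?_)).ofNode
    · refine (Nat.add_le_add_left (ht_invL_le _ _ _) _).trans_lt ?_
      omega
    · rw [ht_wk]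
      refine (Nat.add_le_add_left (ht_invL_le _ _ _) _).trans_lt ?_
      omega
  | impR C D Δ' h a a' ha =>
    rw [ht_ofNode_impR] at hk
    refine (NodeRel.impR _ _ _ _ _ _
      (hw₂ _ _ _ _ _ _ (ha.wk _ _) (hY.invR _ _) ?_)).ofNode
    rw [ht_wk]
    refine (Nat.add_le_add_left (ht_invR_le _ _ _) _).trans_lt ?_
    omega
  | cut _ _ _ _ _ _ hp => exact rel_plainCut hp hX hY
  | box Γ' Δ' Θ l hl h h' a bs a' bs' ha hbs =>
    by_cases hd : (↑l : Multiset Formula).map Formula.box ≤ Δ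
    · simp only [stepNode, dif_pos hd]
      exact rel_boxTo _ _ _ ha hbs
    simp only [stepNode, dif_neg hd]
    cases hy with
    | axP => exact (NodeRel.axP _ _ _ _ _).ofNode
    | axBot => exact (NodeRel.axBot _ _).ofNode
    | impL C D Γ' h a b a' b' ha hb =>
      rw [ht_ofNode_impL] at hk
      refine (NodeRel.impL _ _ _ _ _ _ _ _ (hw₂ _ _ _ _ _ _ (hX.invL _ _) (ha.wk _ _) ?_)
        (hw₂ _ _ _ _ _ _ (hX.invL _ _) (hb.wk _ _) ?_)).ofNode
      · rw [ht_wk]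
        refine (Nat.add_le_add_right (ht_invL_le _ _ _) _).trans_lt ?_
        omega
      · rw [ht_wk]
        refine (Nat.add_le_add_right (ht_invL_le _ _ _) _).trans_lt ?_
        omega
    | impR C D Δ' h a a' ha =>
      rw [ht_ofNode_impR] at hk
      refine (NodeRel.impR _ _ _ _ _ _
        (hw₂ _ _ _ _ _ _ (hX.invR _ _) (ha.wk _ _) ?_)).ofNode
      rw [ht_wk]
      refine (Nat.add_le_add_right (ht_invR_le _ _ _) _).trans_lt ?_
      omega
    | cut _ _ _ _ _ _ hp => exact rel_plainCut hp hX hY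
    | box Γ₁ Δ₁ Θ₁ m hm h₁ h₁' a₁ bs₁ a₁' bs₁' ha₁ hbs₁ =>
      by_cases hd₁ : Θ₁.map Formula.box ≤ Γ
      · simp only [dif_pos hd₁]
        exact rel_boxTo _ _ _ ha₁ hbs₁
      simp only [dif_neg hd₁]
      rw [ht_ofNode_box, ht_ofNode_box] at hk
      exact rel_principal hU hw₁ hw₂ _ _ _ _ _ _ _ ha hbs ha₁ hbs₁ (by omega)

end

/-! ### The limit of the approximations -/

section Limit

variable {B : Formula} (U : CutOp B)

/-- Approximations to the removal of cuts on `□B`, correct up to the `n`-fragment on cut pairs of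
total local height below `k`. -/
noncomputable def approx : ℕ → ℕ → CutOp B.box
  | 0, _ => plainCut B.box
  | _ + 1, 0 => plainCut B.box
  | n + 1, k + 1 => fun _ _ π τ =>
    stepNode U (fun Γ Δ π τ => approx n (π.ht + τ.ht + 1) Γ Δ π τ) (approx (n + 1) k) π.node τ.node

theorem relBelow_approx {p : Prop} (hU : ∀ n, RelOp n p U U) (n : ℕ) :
    ∀ k N N' K K' : ℕ, n ≤ N → n ≤ N' → k ≤ K → k ≤ K' →
      RelBelow n p k (approx U N K) (approx U N' K') := by
  induction n with
  | zero => intro _ _ _ _ _ _ _ _ _ _ _ _ _ _ _ _ _ _; exact rel_zero _ _ _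
  | succ n ihn =>
    intro k
    induction k with
    | zero => intro _ _ _ _ _ _ _ _ _ _ _ _ _ _ _ _ h; exact absurd h (Nat.not_lt_zero _)
    | succ k ihk =>
      intro N N' K K' hN hN' hK hK' Γ Δ π π' τ τ' hπ hτ hk
      obtain ⟨N, rfl⟩ := Nat.exists_eq_add_of_lt hN
      obtain ⟨N', rfl⟩ := Nat.exists_eq_add_of_lt hN'
      obtain ⟨K, rfl⟩ := Nat.exists_eq_add_of_lt hK
      obtain ⟨K', rfl⟩ := Nat.exists_eq_add_of_lt hK'
      simp only [approx]
      refine rel_stepNode (k := k) hU ?_ (ihk _ _ _ _ (by omega) (by omega) (by omega) (by omega))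
        hπ.node hτ.node (by rwa [ofNode_node, ofNode_node])
      intro Γ Δ π π' τ τ' hπ hτ
      cases n with
      | zero => exact rel_zero _ _ _
      | succ n =>
        exact ihn (π.ht + τ.ht + 1) _ _ _ _ (by omega) (by omega) le_rfl
          (by rw [hπ.ht_eq, hτ.ht_eq]) _ _ _ _ _ _ hπ hτ (Nat.lt_succ_self _)

theorem relOp_approx {p : Prop} (hU : ∀ n, RelOp n p U U) {n N N' : ℕ} (hN : n ≤ N)
    (hN' : n ≤ N') :
    RelOp n p (fun Γ Δ π τ => approx U N (π.ht + τ.ht + 1) Γ Δ π τ)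
      (fun Γ Δ π τ => approx U N' (π.ht + τ.ht + 1) Γ Δ π τ) := by
  intro Γ Δ π π' τ τ' hπ hτ
  cases n with
  | zero => exact rel_zero _ _ _
  | succ n =>
    exact relBelow_approx U hU (n + 1) (π.ht + τ.ht + 1) _ _ _ _ hN hN' le_rfl
      (by rw [hπ.ht_eq, hτ.ht_eq]) _ _ _ _ _ _ hπ hτ (Nat.lt_succ_self _)

theorem rel_false_refl {Γ Δ : Multiset Formula} (n : ℕ) (π : InfProof true Γ Δ) :
    Rel n False π π :=
  ⟨rfl, False.elim⟩

noncomputable def removeBox (hU : ∀ n, RelOp n False U U) : CutOp B.box := fun Γ Δ π τ =>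
  { frag := fun n => (approx U n (π.ht + τ.ht + 1) Γ Δ π τ).frag n
    compat := fun n => by
      rw [InfProof.compat]
      exact (relOp_approx U hU n.le_succ le_rfl _ _ _ _ _ _ (rel_false_refl n π)
        (rel_false_refl n τ)).1 }

theorem relOp_removeBox (hU : ∀ p n, RelOp n p U U) (p : Prop) (n : ℕ) :
    RelOp n p (removeBox U (hU False)) (removeBox U (hU False)) :=
  fun _ _ _ _ _ _ hπ hτ => relOp_approx U (hU p) le_rfl le_rfl _ _ _ _ _ _ hπ hτ

end Limit

/-! ### Passing to mappings on all ∞-proofs -/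

theorem sim_mk_iff {n : ℕ} {Γ Δ : Multiset Formula} {π τ : InfProof true Γ Δ} :
    Sim n ⟨Γ, Δ, π⟩ ⟨Γ, Δ, τ⟩ ↔ π.frag n = τ.frag n := by
  cases n with
  | zero => exact iff_of_true trivial (Subsingleton.elim _ _)
  | succ n => simp [Sim]

theorem sim_exists {n : ℕ} {π τ : PP} (h : Sim (n + 1) π τ) :
    ∃ (Γ Δ : Multiset Formula) (a b : InfProof true Γ Δ), π = ⟨Γ, Δ, a⟩ ∧ τ = ⟨Γ, Δ, b⟩ ∧
      a.frag (n + 1) = b.frag (n + 1) := by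
  obtain ⟨Γ, Δ, a⟩ := π
  obtain ⟨Γ', Δ', b⟩ := τ
  obtain ⟨h₁, h₂, h₃⟩ := h
  simp only at h₁ h₂ h₃
  subst h₁ h₂
  exact ⟨Γ, Δ, a, b, rfl, rfl, eq_of_heq h₃⟩

theorem sim_of_le {m n : ℕ} (hm : m ≤ n) {π τ : PP} (h : Sim n π τ) : Sim m π τ := by
  cases n with
  | zero => rwa [Nat.le_zero.1 hm]
  | succ n =>
    obtain ⟨Γ, Δ, a, b, rfl, rfl, e⟩ := sim_exists h
    exact sim_mk_iff.2 (frag_eq_of_le hm e)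

theorem dP_bddBelow (π τ : PP) : BddBelow {r : ℝ | ∃ n : ℕ, Sim n π τ ∧ r = (1/2 : ℝ) ^ n} :=
  ⟨0, by rintro _ ⟨n, -, rfl⟩; positivity⟩

theorem dP_le_of_sim {n : ℕ} {π τ : PP} (h : Sim n π τ) : dP π τ ≤ (1/2 : ℝ) ^ n :=
  csInf_le (dP_bddBelow π τ) ⟨n, h, rfl⟩

theorem exists_sim_of_dP_lt {r : ℝ} {π τ : PP} (h : dP π τ < r) :
    ∃ n, Sim n π τ ∧ (1/2 : ℝ) ^ n < r := by
  have hne : Set.Nonempty {r : ℝ | ∃ n : ℕ, Sim n π τ ∧ r = (1/2 : ℝ) ^ n} :=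
    ⟨1, 0, trivial, (pow_zero _).symm⟩
  obtain ⟨_, ⟨n, hn, rfl⟩, hr⟩ := exists_lt_of_csInf_lt hne h
  exact ⟨n, hn, hr⟩

theorem sim_of_dP_le {n : ℕ} {π τ : PP} (h : dP π τ ≤ (1/2 : ℝ) ^ n) : Sim n π τ := by
  cases n with
  | zero => trivial
  | succ n =>
    obtain ⟨m, hm, hr⟩ := exists_sim_of_dP_lt
      (h.trans_lt (pow_lt_pow_right_of_lt_one₀ (by norm_num) (by norm_num) n.lt_succ_self))
    exact sim_of_le ((pow_lt_pow_iff_right_of_lt_one₀ (by norm_num) (by norm_num)).1 hr) hm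

theorem nonExpansive2_iff {u : PP × PP → PP} :
    NonExpansive2 u ↔ ∀ (n : ℕ) (π π' τ τ' : PP), Sim n π π' → Sim n τ τ' →
      Sim n (u (π, τ)) (u (π', τ')) := by
  constructor
  · intro h n π π' τ τ' hπ hτ
    exact sim_of_dP_le ((h _ _).trans (max_le (dP_le_of_sim hπ) (dP_le_of_sim hτ)))
  · rintro h ⟨π, τ⟩ ⟨π', τ'⟩
    by_contra! hlt
    obtain ⟨h₁, h₂⟩ := max_lt_iff.1 hlt
    obtain ⟨n₁, hn₁, hr₁⟩ := exists_sim_of_dP_lt h₁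
    obtain ⟨n₂, hn₂, hr₂⟩ := exists_sim_of_dP_lt h₂
    have hle := dP_le_of_sim (h _ _ _ _ _ (sim_of_le (min_le_left n₁ n₂) hn₁)
      (sim_of_le (min_le_right n₁ n₂) hn₂))
    rcases min_choice n₁ n₂ with e | e <;> rw [e] at hle <;> linarith

theorem exists_cutOp {A : Formula} {u : PP × PP → PP} (hu : NonExpansive2 u)
    (hr : Removing A u) (ha : Adequate2 u) :
    ∃ U : CutOp A, ∀ p n, RelOp n p U U := by
  have key : ∀ (Γ Δ : Multiset Formula) (π : InfProof true Γ (A ::ₘ Δ))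
      (τ : InfProof true (A ::ₘ Γ) Δ), ∃ σ : InfProof true Γ Δ,
      u (⟨_, _, π⟩, ⟨_, _, τ⟩) = ⟨Γ, Δ, σ⟩ := by
    intro Γ Δ π τ
    obtain ⟨h₁, h₂⟩ := hr Γ Δ ⟨_, _, π⟩ ⟨_, _, τ⟩ rfl rfl rfl rfl
    generalize u (⟨_, _, π⟩, ⟨_, _, τ⟩) = ρ at h₁ h₂
    obtain ⟨Γ', Δ', σ⟩ := ρ
    simp only at h₁ h₂
    subst h₁ h₂
    exact ⟨σ, rfl⟩
  choose U hU using key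
  refine ⟨U, fun p n Γ Δ π π' τ τ' hπ hτ => ⟨?_, fun hp => ?_⟩⟩
  · rw [← sim_mk_iff, ← hU, ← hU]
    exact nonExpansive2_iff.1 hu _ _ _ _ _ (sim_mk_iff.2 hπ.1) (sim_mk_iff.2 hτ.1)
  · have := ha n ⟨_, _, π⟩ ⟨_, _, τ⟩ (hπ.2 hp) (hτ.2 hp)
    rwa [hU] at this

open Classical in
/-- The mapping on all pairs of ∞-proofs that agrees with `w` on cut pairs. -/
noncomputable def toMap {A : Formula} (w : CutOp A) (x : PP × PP) : PP :=
  if h : x.1.Δ = A ::ₘ x.2.Δ ∧ x.2.Γ = A ::ₘ x.1.Γ then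
    ⟨x.1.Γ, x.2.Δ, w _ _ (h.1 ▸ x.1.prf) (h.2 ▸ x.2.prf)⟩
  else x.1

theorem toMap_mk {A : Formula} (w : CutOp A) {Γ Δ : Multiset Formula}
    (π : InfProof true Γ (A ::ₘ Δ)) (τ : InfProof true (A ::ₘ Γ) Δ) :
    toMap w (⟨_, _, π⟩, ⟨_, _, τ⟩) = ⟨Γ, Δ, w Γ Δ π τ⟩ :=
  dif_pos ⟨rfl, rfl⟩

theorem nonExpansive2_toMap {A : Formula} {w : CutOp A} (hw : ∀ n, RelOp n False w w) :
    NonExpansive2 (toMap w) := by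
  rw [nonExpansive2_iff]
  intro n π π' τ τ' hπ hτ
  cases n with
  | zero => trivial
  | succ n =>
    obtain ⟨Γ, Δ, a, a', rfl, rfl, ha⟩ := sim_exists hπ
    obtain ⟨Γ', Δ', b, b', rfl, rfl, hb⟩ := sim_exists hτ
    by_cases h : Δ = A ::ₘ Δ' ∧ Γ' = A ::ₘ Γ
    · obtain ⟨rfl, rfl⟩ := h
      rw [toMap_mk, toMap_mk, sim_mk_iff]
      exact (hw _ _ _ _ _ _ _ ⟨ha, False.elim⟩ ⟨hb, False.elim⟩).1
    · rw [toMap, toMap, dif_neg h, dif_neg h]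
      exact hπ

theorem removing_toMap {A : Formula} (w : CutOp A) : Removing A (toMap w) := by
  rintro Γ Δ ⟨Γ₁, Δ₁, π⟩ ⟨Γ₂, Δ₂, τ⟩ h₁ h₂ h₃ h₄
  simp only at h₁ h₂ h₃ h₄
  subst h₁ h₂ h₃ h₄
  rw [toMap_mk]
  exact ⟨rfl, rfl⟩

theorem adequate2_toMap {A : Formula} {w : CutOp A} (hw : ∀ n, RelOp n True w w) :
    Adequate2 (toMap w) := by
  rintro n ⟨Γ, Δ, a⟩ ⟨Γ', Δ', b⟩ ha hb
  by_cases h : Δ = A ::ₘ Δ' ∧ Γ' = A ::ₘ Γ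
  · obtain ⟨rfl, rfl⟩ := h
    rw [toMap_mk]
    exact (hw n _ _ _ _ _ _ ⟨rfl, fun _ => ha⟩ ⟨rfl, fun _ => hb⟩).2 trivial
  · rw [toMap, dif_neg h]
    exact ha

end GoCut

theorem stmt17 (B : Formula)
    (h : ∃ u : PP × PP → PP, NonExpansive2 u ∧ Removing B u ∧ Adequate2 u) :
    ∃ v : PP × PP → PP,
      NonExpansive2 v ∧ Removing (Formula.box B) v ∧ Adequate2 v := by
  obtain ⟨u, hu, hr, ha⟩ := h
  obtain ⟨U, hU⟩ := GoCut.exists_cutOp hu hr ha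
  have hw := GoCut.relOp_removeBox U hU
  exact ⟨GoCut.toMap (GoCut.removeBox U (hU False)), GoCut.nonExpansive2_toMap (hw False),
    GoCut.removing_toMap _, GoCut.adequate2_toMap (hw True)⟩
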